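/- There is an absolute constant C ≥ 1 such that the following holds. Let p be an odd prime, Γ ⊆ F_p^* a multiplicative subgroup, and Q ⊆ F_p^* a set with QΓ = Q. Then for any integer k ≥ 2 with 2^{64k} C⁴ ≤ |Γ| one has T⁺_{2^k}(Q) ≤ 2^{4k+6} C (log|Γ|)⁴ · |Q|^{2^{k+1}}/p + 16^{k²} C^{k−1} (log|Γ|)^{4(k−1)} · |Γ|^{−(k+7)/2} · E⁺(Γ) · |Q|^{2^{k+1}}. -/

import Mathlib

open Finset Pointwise

/-- `Γ` is a multiplicative subgroup of `F_p^*` (as a finite set of field elements). -/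
def IsMulSubgroup {F : Type*} [Field F] [DecidableEq F] (Γ : Finset F) : Prop :=
  (0 : F) ∉ Γ ∧ (1 : F) ∈ Γ ∧ (∀ x ∈ Γ, ∀ y ∈ Γ, x * y ∈ Γ) ∧ (∀ x ∈ Γ, x⁻¹ ∈ Γ)

/-- `T⁺_m(A) = #{(a1,…,am,a1',…,am') ∈ A^{2m} : a1+⋯+am = a1'+⋯+am'}`. -/
def Tplus {G : Type*} [AddCommMonoid G] [DecidableEq G] (m : ℕ) (A : Finset G) : ℕ :=
  (((Fintype.piFinset fun _ : Fin m => A) ×ˢ (Fintype.piFinset fun _ : Fin m => A)).filter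
    fun x => ∑ i, x.1 i = ∑ i, x.2 i).card

/-- The additive energy `E⁺(Γ)`. -/
def Eplus {G : Type*} [AddCommGroup G] [DecidableEq G] (Q : Finset G) : ℕ :=
  ((Q ×ˢ Q ×ˢ Q ×ˢ Q).filter fun q => q.1 + q.2.1 = q.2.2.1 + q.2.2.2).card

universe u

section Elimination
open MvPolynomial

theorem totalDegree_resultant_le {σ K : Type*} [Field K] (f g : Polynomial (MvPolynomial σ K))
    (a b m n : ℕ) (hf : ∀ i, (f.coeff i).totalDegree ≤ a)
    (hg : ∀ i, (g.coeff i).totalDegree ≤ b) :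
    (Polynomial.resultant f g m n).totalDegree ≤ m * b + n * a := by
  rw [Polynomial.resultant, Matrix.det_apply]
  refine MvPolynomial.totalDegree_finsetSum_le fun s _ => ?_
  refine (MvPolynomial.totalDegree_smul_le _ _).trans ?_
  refine (MvPolynomial.totalDegree_finsetProd _ _).trans ?_
  rw [Fin.sum_univ_add]
  refine add_le_add ?_ ?_
  · refine (Finset.sum_le_card_nsmul _ _ b fun j _ => ?_).trans (by simp)
    simp only [Polynomial.sylvester, Matrix.of_apply, Fin.addCases_left]
    split_ifs
    · exact hg _
    · simp
  · refine (Finset.sum_le_card_nsmul _ _ a fun j _ => ?_).trans (by simp)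
    simp only [Polynomial.sylvester, Matrix.of_apply, Fin.addCases_right]
    split_ifs
    · exact hf _
    · simp

theorem resultant_ne_zero_of_irreducible {R : Type*} [CommRing R] [IsDomain R]
    [UniqueFactorizationMonoid R] {f g : Polynomial R} (hf : Irreducible f)
    (hd : f.natDegree ≠ 0) (h : ¬ f ∣ g) : Polynomial.resultant f g ≠ 0 := by
  obtain ⟨_⟩ : Nonempty (NormalizedGCDMonoid R) := inferInstance
  have hp : f.IsPrimitive := hf.isPrimitive hd
  set φ := algebraMap R (FractionRing R)
  have hφ : Function.Injective φ := IsFractionRing.injective R (FractionRing R)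
  have hirr : Irreducible (f.map φ) :=
    (hp.irreducible_iff_irreducible_map_fraction_map (K := FractionRing R)).1 hf
  have hndvd : ¬ f.map φ ∣ g.map φ := by
    intro hdvd
    exact h (hp.dvd_of_fraction_map_dvd_fraction_map (K := FractionRing R) hdvd)
  have hcop : IsCoprime (f.map φ) (g.map φ) :=
    (hirr.coprime_iff_not_dvd).2 hndvd
  intro h0
  have := Polynomial.resultant_map_map f g f.natDegree g.natDegree φ
  rw [h0, map_zero] at this
  have h1 := (Polynomial.resultant_ne_zero (f.map φ) (g.map φ) hcop)
  rw [Polynomial.natDegree_map_eq_of_injective hφ,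
    Polynomial.natDegree_map_eq_of_injective hφ] at h1
  exact h1 this

theorem exists_eliminant_zero {K : Type u} [Field K] {n : ℕ}
    {G H : MvPolynomial (Fin (n + 1)) K} (hG : Irreducible G) (hd : G.degreeOf 0 ≠ 0)
    (h : ¬ G ∣ H) :
    ∃ r : MvPolynomial (Fin n) K, r ≠ 0 ∧ r.totalDegree ≤ 2 * (G.totalDegree * H.totalDegree) ∧
      ∀ {S : Type u} [CommRing S] [Algebra K S] (φ : MvPolynomial (Fin (n + 1)) K →ₐ[K] S),
        φ G = 0 → φ H = 0 → aeval (fun j : Fin n => φ (X j.succ)) r = 0 := by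
  set f := finSuccEquiv K n G
  set g := finSuccEquiv K n H
  have hf : Irreducible f := (MulEquiv.irreducible_iff (finSuccEquiv K n)).2 hG
  have hfd : f.natDegree ≠ 0 := by rwa [natDegree_finSuccEquiv]
  have hfg : ¬ f ∣ g := fun hh => h ((map_dvd_iff (finSuccEquiv K n)).1 hh)
  have hcf (F : MvPolynomial (Fin (n + 1)) K) (i : ℕ) :
      ((finSuccEquiv K n F).coeff i).totalDegree ≤ F.totalDegree := by
    by_cases h0 : (finSuccEquiv K n F).coeff i = 0
    · simp [h0]
    · exact (Nat.le_add_right _ _).trans (totalDegree_coeff_finSuccEquiv_add_le F i h0)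
  refine ⟨Polynomial.resultant f g, resultant_ne_zero_of_irreducible hf hfd hfg, ?_, ?_⟩
  · refine (totalDegree_resultant_le f g _ _ _ _ (hcf G) (hcf H)).trans ?_
    rw [natDegree_finSuccEquiv, natDegree_finSuccEquiv]
    have h1 := Nat.mul_le_mul_right H.totalDegree (degreeOf_le_totalDegree G 0)
    have h2 := Nat.mul_le_mul_right G.totalDegree (degreeOf_le_totalDegree H 0)
    nlinarith
  · intro S _ _ φ hφG hφH
    obtain ⟨u, v, -, -, huv⟩ := Polynomial.exists_mul_add_mul_eq_C_resultant f g le_rfl le_rfl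
      (Or.inl hfd)
    have hkey : (φ.comp (finSuccEquiv K n).symm.toAlgHom)
        (Polynomial.C (Polynomial.resultant f g)) = 0 := by
      rw [← huv]
      simp [f, g, hφG, hφH]
    have hC : ∀ r : MvPolynomial (Fin n) K, (φ.comp (finSuccEquiv K n).symm.toAlgHom)
        (Polynomial.C r) = aeval (fun j : Fin n => φ (X j.succ)) r := by
      intro r
      have : (φ.comp (finSuccEquiv K n).symm.toAlgHom).comp
          (IsScalarTower.toAlgHom K (MvPolynomial (Fin n) K) (Polynomial (MvPolynomial (Fin n) K)))
            = aeval (fun j : Fin n => φ (X j.succ)) := by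
        refine MvPolynomial.algHom_ext fun j => ?_
        have : (finSuccEquiv K n).symm (Polynomial.C (X j)) = X j.succ := by
          rw [AlgEquiv.symm_apply_eq, finSuccEquiv_X_succ]
        simp [this]
      exact DFunLike.congr_fun this r
    rw [← hC, hkey]

theorem exists_eliminant {K : Type u} [Field K] {n : ℕ} (e : Equiv.Perm (Fin (n + 1)))
    {G H : MvPolynomial (Fin (n + 1)) K} (hG : Irreducible G) (hd : G.degreeOf (e 0) ≠ 0)
    (h : ¬ G ∣ H) :
    ∃ r : MvPolynomial (Fin n) K, r ≠ 0 ∧ r.totalDegree ≤ 2 * (G.totalDegree * H.totalDegree) ∧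
      ∀ {S : Type u} [CommRing S] [Algebra K S] (φ : MvPolynomial (Fin (n + 1)) K →ₐ[K] S),
        φ G = 0 → φ H = 0 → aeval (fun j : Fin n => φ (X (e j.succ))) r = 0 := by
  set E := renameEquiv K e.symm
  have hG' : Irreducible (E G) := (MulEquiv.irreducible_iff E).2 hG
  have hd' : (E G).degreeOf 0 ≠ 0 := by
    have := degreeOf_rename_of_injective (p := G) e.symm.injective (e 0)
    rw [Equiv.symm_apply_apply] at this
    simpa [E, this] using hd
  obtain ⟨r, hr, hdeg, hφ⟩ := exists_eliminant_zero hG' hd'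
    (fun hh => h ((map_dvd_iff E).1 hh))
  refine ⟨r, hr, ?_, ?_⟩
  · simpa only [E, totalDegree_renameEquiv] using hdeg
  · intro S _ _ φ h1 h2
    have := hφ (φ.comp E.symm.toAlgHom) (by simpa using h1) (by simpa using h2)
    simpa [E] using this

end Elimination

section Lines
open MvPolynomial

theorem derivation_aeval {K S σ : Type*} [Field K] [CommRing S] [Algebra K S] [Fintype σ]
    (D : Derivation K S S) (f : σ → S) (G : MvPolynomial σ K) :
    D (aeval f G) = ∑ i, aeval f (pderiv i G) * D (f i) := by
  classical
  induction G using MvPolynomial.induction_on with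
  | C a => simp
  | add p q hp hq => simp [hp, hq, add_mul, Finset.sum_add_distrib]
  | mul_X p j hp =>
    simp only [map_mul, aeval_X, Derivation.leibniz, hp, pderiv_X, smul_eq_mul, map_add,
      add_mul, Finset.sum_add_distrib, Finset.mul_sum]
    congr 1
    · rw [Finset.sum_eq_single j]
      · simp
      · intro i _ hi
        simp [Ne.symm hi]
      · simp
    · exact Finset.sum_congr rfl fun i _ => by ring

theorem pderiv_comm {K σ : Type*} [CommSemiring K] (i j : σ) (G : MvPolynomial σ K) :
    pderiv i (pderiv j G) = pderiv j (pderiv i G) := by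
  classical
  ext m
  simp only [coeff_pderiv]
  by_cases h : i = j
  · subst h; rfl
  · simp only [Finsupp.add_apply, Finsupp.single_apply, h, Ne.symm h, if_false, add_zero]
    rw [add_right_comm]; ring

theorem degree_succ_le_of_mem_support_pderiv {K σ : Type*} [CommSemiring K] {i : σ}
    {G : MvPolynomial σ K} {m : σ →₀ ℕ} (hm : m ∈ (pderiv i G).support) :
    (m.sum fun _ e => e) + 1 ≤ G.totalDegree := by
  classical
  rw [mem_support_iff, coeff_pderiv] at hm
  have h1 : m + Finsupp.single i 1 ∈ G.support := by
    rw [mem_support_iff]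
    exact left_ne_zero_of_mul hm
  have h2 := le_totalDegree h1
  rw [Finsupp.sum_add_index' (by simp) (by simp)] at h2
  simpa using h2

theorem totalDegree_pderiv_le {K σ : Type*} [CommSemiring K] (i : σ) (G : MvPolynomial σ K) :
    (pderiv i G).totalDegree ≤ G.totalDegree :=
  Finset.sup_le fun _ hm => (Nat.le_succ _).trans (degree_succ_le_of_mem_support_pderiv hm)

theorem totalDegree_pderiv_lt {K σ : Type*} [CommSemiring K] {i : σ} {G : MvPolynomial σ K}
    (h : pderiv i G ≠ 0) : (pderiv i G).totalDegree < G.totalDegree := by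
  obtain ⟨m, hm⟩ := MvPolynomial.support_nonempty.2 h
  refine (Finset.sup_lt_iff ?_).2 fun _ hm' => degree_succ_le_of_mem_support_pderiv hm'
  exact lt_of_lt_of_le (Nat.succ_pos _) (degree_succ_le_of_mem_support_pderiv hm)

theorem notMem_vars_of_pderiv_eq_zero {K σ : Type*} [Field K] {p : ℕ} [CharP K p] {i : σ}
    {G : MvPolynomial σ K} (h : pderiv i G = 0) (hd : G.totalDegree < p) : i ∉ G.vars := by
  classical
  intro hi
  obtain ⟨m, hm, him⟩ := (mem_vars_iff_mem_support i).1 hi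
  have hmi : m i ≠ 0 := by simpa using him
  have h1 := congrArg (coeff (m - Finsupp.single i 1)) h
  have hle : Finsupp.single i 1 ≤ m := by
    rw [Finsupp.single_le_iff]; omega
  rw [coeff_pderiv, tsub_add_cancel_of_le hle, coeff_zero, Finsupp.tsub_apply,
    Finsupp.single_eq_same] at h1
  have h2 : ((m i : ℕ) : K) = 0 := by
    have := (mul_eq_zero.1 h1).resolve_left (mem_support_iff.1 hm)
    rw [← this, ← Nat.cast_succ]; congr 1; omega
  rw [CharP.cast_eq_zero_iff K p] at h2
  have h3 : m i ≤ G.totalDegree := by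
    refine le_trans ?_ (le_totalDegree hm)
    rw [Finsupp.sum]
    exact Finset.single_le_sum (f := fun j => m j) (fun _ _ => Nat.zero_le _) him
  exact absurd (Nat.le_of_dvd (Nat.pos_of_ne_zero hmi) h2) (by omega)

theorem dvd_sub_aeval {K σ : Type*} [Field K] (L : MvPolynomial σ K) (v : σ → MvPolynomial σ K)
    (hv : ∀ i, L ∣ X i - v i) (G : MvPolynomial σ K) : L ∣ G - aeval v G := by
  rw [← Ideal.Quotient.eq_zero_iff_dvd, map_sub, sub_eq_zero]
  have : (Ideal.Quotient.mkₐ K (Ideal.span {L})) =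
      (Ideal.Quotient.mkₐ K (Ideal.span {L})).comp (aeval v) := by
    refine algHom_ext fun i => ?_
    simp only [AlgHom.comp_apply, aeval_X, Ideal.Quotient.mkₐ_eq_mk]
    rw [← sub_eq_zero, ← map_sub, Ideal.Quotient.eq_zero_iff_dvd]
    exact hv i
  exact DFunLike.congr_fun this G

variable {K : Type u} [Field K]

/-- Restriction of a polynomial in `(Z, Y, X)` to the line `X = a`, `Z = x + s Y`,
where `l = (a, x, s)`. -/
noncomputable def lineA (l : K × K × K) : MvPolynomial (Fin 3) K →ₐ[K] Polynomial K :=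
  aeval ![Polynomial.C l.2.1 + Polynomial.C l.2.2 * Polynomial.X, Polynomial.X,
    Polynomial.C l.1]

/-- Restriction of a polynomial in `(Z, Y, X)` to the line `Y = b`, `Z = y + t X`,
where `l = (b, y, t)`. -/
noncomputable def lineB (l : K × K × K) : MvPolynomial (Fin 3) K →ₐ[K] Polynomial K :=
  aeval ![Polynomial.C l.2.1 + Polynomial.C l.2.2 * Polynomial.X, Polynomial.C l.1,
    Polynomial.X]

/-- The lines `X = a, Z = x + s Y` and `Y = b, Z = y + t X` meet. -/
def Cross (A B : K × K × K) : Prop := A.2.1 + A.2.2 * B.1 = B.2.1 + B.2.2 * A.1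

instance [DecidableEq K] (A B : K × K × K) : Decidable (Cross A B) :=
  inferInstanceAs (Decidable (_ = _))

theorem eval_lineA_eq_eval_lineB {A B : K × K × K} (h : Cross A B) (G : MvPolynomial (Fin 3) K) :
    (lineA A G).eval B.1 = (lineB B G).eval A.1 := by
  have : (Polynomial.aeval B.1).comp (lineA A) = (Polynomial.aeval A.1).comp (lineB B) := by
    refine algHom_ext fun i => ?_
    fin_cases i
    · simpa [lineA, lineB, Cross] using h
    · simp [lineA, lineB]
    · simp [lineA, lineB]
  simpa [Polynomial.aeval_def] using DFunLike.congr_fun this G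

theorem natDegree_lineB_le (B : K × K × K) (G : MvPolynomial (Fin 3) K) :
    (lineB B G).natDegree ≤ G.totalDegree := by
  have := MvPolynomial.aeval_natDegree_le (n := 1) G le_rfl
    ![Polynomial.C B.2.1 + Polynomial.C B.2.2 * Polynomial.X, Polynomial.C B.1, Polynomial.X] (by
      intro i
      fin_cases i
      · simpa [add_comm] using Polynomial.natDegree_linear_le (a := B.2.2) (b := B.2.1)
      · simp
      · simp)
  simpa [lineB] using this

theorem card_cross_le [DecidableEq K] {F : MvPolynomial (Fin 3) K} {𝒜 : Finset (K × K × K)}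
    (hA : ∀ A ∈ 𝒜, ∀ A' ∈ 𝒜, A.1 = A'.1 → A.2.2 = A'.2.2) (hF : ∀ A ∈ 𝒜, lineA A F = 0)
    {B : K × K × K} (hB : lineB B F ≠ 0) :
    (𝒜.filter fun A => Cross A B).card ≤ F.totalDegree := by
  have h1 : (𝒜.filter fun A => Cross A B).card ≤ (lineB B F).roots.toFinset.card := by
    refine Finset.card_le_card_of_injOn (fun A => A.1) ?_ ?_
    · intro A hA'
      rw [Finset.mem_coe, Finset.mem_filter] at hA'
      simp only [Finset.mem_coe, Multiset.mem_toFinset, Polynomial.mem_roots hB,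
        Polynomial.IsRoot.def]
      rw [← eval_lineA_eq_eval_lineB hA'.2, hF A hA'.1, Polynomial.eval_zero]
    · intro A h A' h' haa
      rw [Finset.mem_coe, Finset.mem_filter] at h h'
      have hs := hA A h.1 A' h'.1 haa
      have h2 := h.2
      have h3 := h'.2
      simp only [Cross] at h2 h3
      simp only at haa
      refine Prod.ext haa (Prod.ext ?_ hs)
      rw [← haa, ← hs] at h3
      exact add_right_cancel (h2.trans h3.symm)
  exact h1.trans ((Multiset.toFinset_card_le _).trans
    ((Polynomial.card_roots' _).trans (natDegree_lineB_le B F)))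

/-- The polynomial whose vanishing detects second order contact of the level surface of `G`
with lines in planes `X = const`. -/
noncomputable def contact (G : MvPolynomial (Fin 3) K) : MvPolynomial (Fin 3) K :=
  pderiv 1 (pderiv 1 G) * pderiv 0 G ^ 2
    - 2 * pderiv 0 (pderiv 1 G) * pderiv 1 G * pderiv 0 G
    + pderiv 0 (pderiv 0 G) * pderiv 1 G ^ 2

theorem totalDegree_contact_le (G : MvPolynomial (Fin 3) K) :
    (contact G).totalDegree ≤ 3 * G.totalDegree := by
  have h1 (i : Fin 3) := totalDegree_pderiv_le i G
  have h2 (i j : Fin 3) := (totalDegree_pderiv_le i (pderiv j G)).trans (h1 j)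
  have hm (P Q R : MvPolynomial (Fin 3) K) (hP : P.totalDegree ≤ G.totalDegree)
      (hQ : Q.totalDegree ≤ G.totalDegree) (hR : R.totalDegree ≤ G.totalDegree) :
      (P * Q * R).totalDegree ≤ 3 * G.totalDegree := by
    have := totalDegree_mul (P * Q) R
    have := totalDegree_mul P Q
    omega
  have e : contact G = (pderiv 1 (pderiv 1 G) * pderiv 0 G * pderiv 0 G
    - (2 : K) • (pderiv 0 (pderiv 1 G) * pderiv 1 G * pderiv 0 G))
    + pderiv 0 (pderiv 0 G) * pderiv 1 G * pderiv 1 G := by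
    rw [MvPolynomial.smul_eq_C_mul]
    simp only [contact, map_ofNat]
    ring
  rw [e]
  refine (totalDegree_add _ _).trans (max_le ((totalDegree_sub _ _).trans (max_le ?_ ?_)) ?_)
  · exact hm _ _ _ (h2 _ _) (h1 _) (h1 _)
  · exact (totalDegree_smul_le _ _).trans (hm _ _ _ (h2 _ _) (h1 _) (h1 _))
  · exact hm _ _ _ (h2 _ _) (h1 _) (h1 _)

theorem derivative_lineA (A : K × K × K) (G : MvPolynomial (Fin 3) K) :
    Polynomial.derivative (lineA A G) =
      lineA A (pderiv 0 G) * Polynomial.C A.2.2 + lineA A (pderiv 1 G) := by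
  have := derivation_aeval (K := K) Polynomial.derivative'
    ![Polynomial.C A.2.1 + Polynomial.C A.2.2 * Polynomial.X, Polynomial.X, Polynomial.C A.1] G
  simpa [Fin.sum_univ_three, lineA, Polynomial.derivative'] using this

theorem lineA_contact {A : K × K × K} {G : MvPolynomial (Fin 3) K} (h : lineA A G = 0) :
    lineA A (contact G) = 0 := by
  have h1 := derivative_lineA A G
  rw [h, map_zero] at h1
  have h2 := congrArg Polynomial.derivative h1
  simp only [map_zero, Polynomial.derivative_add, Polynomial.derivative_mul, derivative_lineA,
    Polynomial.derivative_C, mul_zero, add_zero] at h2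
  rw [pderiv_comm 1 0] at h2
  simp only [contact, map_add, map_sub, map_mul, map_pow, map_ofNat]
  set gz := lineA A (pderiv 0 G)
  set gy := lineA A (pderiv 1 G)
  have e : gy = - (gz * Polynomial.C A.2.2) := by linear_combination -h1
  rw [e]
  linear_combination -gz ^ 2 * h2

theorem dvd_of_lineB_eq_zero {B : K × K × K} {G : MvPolynomial (Fin 3) K} (h : lineB B G = 0)
    (h1 : (1 : Fin 3) ∉ G.vars) : X 0 - C B.2.1 - C B.2.2 * X 2 ∣ G := by
  have := dvd_sub_aeval (X 0 - C B.2.1 - C B.2.2 * X 2 : MvPolynomial (Fin 3) K)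
    ![C B.2.1 + C B.2.2 * X 2, X 1, X 2] (by
      intro i
      fin_cases i
      · simp [sub_sub]
      · simp
      · simp) G
  have e : aeval ![C B.2.1 + C B.2.2 * X 2, X 1, (X 2 : MvPolynomial (Fin 3) K)] G
      = (Polynomial.aeval (X 2 : MvPolynomial (Fin 3) K)) (lineB B G) := by
    refine hom_congr_vars
      (f₁ := (aeval ![C B.2.1 + C B.2.2 * X 2, X 1, (X 2 : MvPolynomial (Fin 3) K)]).toRingHom)
      (f₂ := ((Polynomial.aeval (X 2 : MvPolynomial (Fin 3) K)).comp (lineB B)).toRingHom) ?_ ?_ rfl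
    · ext; simp [lineB]
    · intro i hi _
      fin_cases i
      · simp [lineB, MvPolynomial.algebraMap_eq]
      · exact absurd hi h1
      · simp [lineB]
  rwa [e, h, map_zero, sub_zero] at this

theorem dvd_of_lineA_eq_zero {A : K × K × K} {G : MvPolynomial (Fin 3) K} (h : lineA A G = 0)
    (h1 : (0 : Fin 3) ∉ G.vars) : X 2 - C A.1 ∣ G := by
  have := dvd_sub_aeval (X 2 - C A.1 : MvPolynomial (Fin 3) K)
    ![X 0, X 1, C A.1] (by
      intro i
      fin_cases i
      · simp
      · simp
      · simp) G
  have e : aeval ![X 0, X 1, (C A.1 : MvPolynomial (Fin 3) K)] G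
      = (Polynomial.aeval (X 1 : MvPolynomial (Fin 3) K)) (lineA A G) := by
    refine hom_congr_vars
      (f₁ := (aeval ![X 0, X 1, (C A.1 : MvPolynomial (Fin 3) K)]).toRingHom)
      (f₂ := ((Polynomial.aeval (X 1 : MvPolynomial (Fin 3) K)).comp (lineA A)).toRingHom) ?_ ?_ rfl
    · ext; simp [lineA]
    · intro i hi _
      fin_cases i
      · exact absurd hi h1
      · simp [lineA]
      · simp [lineA, MvPolynomial.algebraMap_eq]
  rwa [e, h, map_zero, sub_zero] at this

end Lines

section Surfaces
open MvPolynomial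

variable {K : Type u} [Field K]

theorem exists_bivariate_eliminant (e : Equiv.Perm (Fin 3)) {G H : MvPolynomial (Fin 3) K}
    (hG : Irreducible G) (hd : G.degreeOf (e 0) ≠ 0) (h : ¬ G ∣ H) :
    ∃ R : Polynomial (Polynomial K), R ≠ 0 ∧
      R.natDegree ≤ 2 * (G.totalDegree * H.totalDegree) ∧
      ∀ {S : Type u} [CommRing S] [Algebra K S] (φ : MvPolynomial (Fin 3) K →ₐ[K] S),
        φ G = 0 → φ H = 0 →
          R.eval₂ (Polynomial.aeval (φ (X (e 2)))).toRingHom (φ (X (e 1))) = 0 := by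
  obtain ⟨r, hr, hdeg, hφ⟩ := exists_eliminant e hG hd h
  let ι : MvPolynomial (Fin 1) K →ₐ[K] Polynomial K := aeval fun _ => Polynomial.X
  have hι : Function.Injective ι := by
    have : (Polynomial.aeval (X 0 : MvPolynomial (Fin 1) K)).comp ι = AlgHom.id K _ := by
      refine algHom_ext fun i => ?_
      simp [ι, Subsingleton.elim i 0]
    exact Function.LeftInverse.injective fun x => DFunLike.congr_fun this x
  refine ⟨(finSuccEquiv K 1 r).map ι.toRingHom, ?_, ?_, ?_⟩
  · rw [Ne, Polynomial.map_eq_zero_iff hι]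
    simpa using hr
  · refine (Polynomial.natDegree_map_le).trans ?_
    rw [natDegree_finSuccEquiv]
    exact (degreeOf_le_totalDegree _ _).trans hdeg
  · intro S _ _ φ h1 h2
    rw [Polynomial.eval₂_map, ← hφ φ h1 h2]
    have hf : (Polynomial.eval₂RingHom ((Polynomial.aeval (φ (X (e 2)))).toRingHom.comp
        ι.toRingHom) (φ (X (e 1)))).comp (finSuccEquiv K 1).toAlgHom.toRingHom =
        (aeval (fun j : Fin 2 => φ (X (e j.succ)))).toRingHom := by
      refine MvPolynomial.ringHom_ext ?_ ?_
      · intro c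
        simp [finSuccEquiv_apply, ι]
      · intro i
        fin_cases i
        · simp [finSuccEquiv_apply]
        · have : finSuccEquiv K 1 (X 1) = Polynomial.C (X 0) := finSuccEquiv_X_succ (j := 0)
          simp [this, ι]
    exact DFunLike.congr_fun hf r

theorem eq_of_lineB_sub_eq_zero {B B' : K × K × K}
    (h : lineB B' (X 0 - C B.2.1 - C B.2.2 * X 2) = 0) : B.2 = B'.2 := by
  simp only [lineB, map_sub, map_mul, aeval_X, algHom_C] at h
  have h0 := congrArg (fun q => Polynomial.coeff q 0) h
  have h1 := congrArg (fun q => Polynomial.coeff q 1) h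
  simp at h0 h1
  exact Prod.ext (sub_eq_zero.1 h0).symm (sub_eq_zero.1 h1).symm

theorem card_le_of_lineB_eq_zero {G H : MvPolynomial (Fin 3) K} (hG : Irreducible G)
    (h : ¬ G ∣ H) {ℬ : Finset (K × K × K)} (hB : ∀ B ∈ ℬ, ∀ B' ∈ ℬ, B.2 = B'.2 → B = B')
    (hBG : ∀ B ∈ ℬ, lineB B G = 0) (hBH : ∀ B ∈ ℬ, lineB B H = 0) :
    ℬ.card ≤ 2 * (G.totalDegree * H.totalDegree) + 1 := by
  classical
  by_cases hd : G.degreeOf 1 = 0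
  · have h1 : (1 : Fin 3) ∉ G.vars := by
      rwa [degreeOf_def, Multiset.count_eq_zero, ← Multiset.mem_toFinset, ← vars_def] at hd
    refine le_trans (Finset.card_le_one.2 fun B hBm B' hBm' => hB B hBm B' hBm' ?_)
      (Nat.le_add_left _ _)
    have hL := dvd_of_lineB_eq_zero (hBG B hBm) h1
    rcases hG.dvd_iff.1 hL with hu | ha
    · have := hu.map (lineB B)
      simp [lineB] at this
    · apply eq_of_lineB_sub_eq_zero
      obtain ⟨c, hc⟩ := ha.dvd
      rw [hc, map_mul, hBG B' hBm', zero_mul]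
  · obtain ⟨R, hR, hdeg, hφ⟩ := exists_bivariate_eliminant (Equiv.swap 0 1) hG (by simpa using hd) h
    refine le_trans ?_ (Nat.le_succ_of_le hdeg)
    refine le_trans ?_ ((Multiset.toFinset_card_le _).trans (Polynomial.card_roots' R))
    refine Finset.card_le_card_of_injOn
      (fun B => Polynomial.C B.2.1 + Polynomial.C B.2.2 * Polynomial.X) ?_ ?_
    · intro B hBm
      have := hφ (lineB B) (hBG B hBm) (hBH B hBm)
      have e2 : Equiv.swap (0 : Fin 3) 1 2 = 2 := by decide
      rw [e2, Equiv.swap_apply_right] at this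
      simp only [lineB, aeval_X] at this
      simp only [Finset.mem_coe, Multiset.mem_toFinset, Polynomial.mem_roots hR,
        Polynomial.IsRoot.def]
      convert this using 1
      simp only [Polynomial.eval, Matrix.cons_val]
      congr 1
      ext <;> simp
    · intro B hBm B' hBm' hbb
      simp only at hbb
      refine hB B hBm B' hBm' (Prod.ext ?_ ?_)
      · simpa using congrArg (fun q => Polynomial.coeff q 0) hbb
      · simpa using congrArg (fun q => Polynomial.coeff q 1) hbb

theorem natDegree_C_add_C_mul_X_le {R : Type*} [Semiring R] (a b : R) :
    (Polynomial.C a + Polynomial.C b * Polynomial.X).natDegree ≤ 1 := by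
  rw [add_comm]
  exact Polynomial.natDegree_linear_le

theorem natDegree_aeval_le {σ : Type*} (F : MvPolynomial σ K)
    (f : σ → Polynomial (Polynomial K)) (hf : ∀ i, (f i).natDegree ≤ 1) :
    (aeval f F).natDegree ≤ F.totalDegree := by
  have := MvPolynomial.aeval_natDegree_le (map (algebraMap K (Polynomial K)) F)
    (Finset.sup_mono (support_map_subset _ _)) f hf
  rwa [aeval_map_algebraMap, mul_one] at this

theorem natDegree_lineA_le (A : K × K × K) (G : MvPolynomial (Fin 3) K) :
    (lineA A G).natDegree ≤ G.totalDegree := by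
  have := MvPolynomial.aeval_natDegree_le (n := 1) G le_rfl
    ![Polynomial.C A.2.1 + Polynomial.C A.2.2 * Polynomial.X, Polynomial.X, Polynomial.C A.1] (by
      intro i
      fin_cases i
      · exact natDegree_C_add_C_mul_X_le _ _
      · simp
      · simp)
  simpa [lineA] using this

theorem exists_lineA_eq_zero (𝒜 : Finset (K × K × K)) {e : ℕ}
    (he : 𝒜.card * (3 * e + 1) < (e + 1) ^ 3) :
    ∃ F : MvPolynomial (Fin 3) K, F ≠ 0 ∧ F.totalDegree ≤ 3 * e ∧ ∀ A ∈ 𝒜, lineA A F = 0 := by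
  classical
  let E : (Fin 3 → Fin (e + 1)) → (Fin 3 →₀ ℕ) :=
    fun i => Finsupp.equivFunOnFinite.symm fun t => (i t : ℕ)
  have hE : Function.Injective E := by
    intro i j h
    have := Finsupp.equivFunOnFinite.symm.injective h
    funext t
    exact Fin.ext (congrFun this t)
  let P : ((Fin 3 → Fin (e + 1)) → K) →ₗ[K] MvPolynomial (Fin 3) K :=
    ∑ i, (monomial (E i)).comp (LinearMap.proj i)
  have hP (c) : P c = ∑ i, monomial (E i) (c i) := by simp [P]
  have hdeg (c) : (P c).totalDegree ≤ 3 * e := by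
    rw [hP]
    refine totalDegree_finsetSum_le fun i _ => ?_
    refine (totalDegree_monomial_le _ _).trans ?_
    rw [Finsupp.sum_fintype _ _ (by simp), Fin.sum_univ_three]
    have h0 := (i 0).is_le
    have h1 := (i 1).is_le
    have h2 := (i 2).is_le
    simp only [E, Finsupp.equivFunOnFinite_symm_apply_apply, id]
    omega
  have hcoeff (c i) : coeff (E i) (P c) = c i := by
    rw [hP, coeff_sum, Finset.sum_eq_single i]
    · simp
    · intro j _ hj
      rw [coeff_monomial, if_neg (fun h => hj (hE h))]
    · simp
  let T : ((Fin 3 → Fin (e + 1)) → K) →ₗ[K] (𝒜 × Fin (3 * e + 1) → K) :=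
    LinearMap.pi fun q => (Polynomial.lcoeff K q.2).comp
      ((lineA (q.1 : K × K × K)).toLinearMap.comp P)
  have hker : LinearMap.ker T ≠ ⊥ := by
    apply LinearMap.ker_ne_bot_of_finrank_lt
    simp only [Module.finrank_fintype_fun_eq_card, Fintype.card_prod, Fintype.card_coe,
      Fintype.card_fin, Fintype.card_fun]
    exact he
  obtain ⟨c, hc, hc0⟩ := (Submodule.ne_bot_iff _).1 hker
  refine ⟨P c, ?_, hdeg c, ?_⟩
  · intro h
    apply hc0
    funext i
    rw [← hcoeff c i, h, coeff_zero, Pi.zero_apply]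
  · intro A hAm
    ext n
    rw [Polynomial.coeff_zero]
    by_cases hn : n < 3 * e + 1
    · have := congrFun (LinearMap.mem_ker.1 hc) (⟨A, hAm⟩, ⟨n, hn⟩)
      simpa [T] using this
    · exact Polynomial.coeff_eq_zero_of_natDegree_lt
        (((natDegree_lineA_le A _).trans (hdeg c)).trans_lt (by omega))

/-- A polynomial vanishing to second order at `0`, and satisfying a second order linear
differential equation with regular leading coefficient, vanishes if its degree is less than the
characteristic. -/
theorem eq_zero_of_ode {R : Type*} [CommRing R] [IsDomain R] {p : ℕ} [CharP R p]
    {φ P Q S : Polynomial R} (h0 : φ.eval 0 = 0) (h1 : φ.derivative.eval 0 = 0)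
    (hP : P.eval 0 ≠ 0) (hd : φ.natDegree < p)
    (h : Q * φ = P * φ.derivative.derivative + φ.derivative * S) : φ = 0 := by
  classical
  by_contra hφ
  have hn : 1 < φ.rootMultiplicity 0 :=
    (Polynomial.one_lt_rootMultiplicity_iff_isRoot hφ).2 ⟨h0, h1⟩
  have hle : φ.rootMultiplicity 0 ≤ φ.natDegree :=
    (Polynomial.count_roots φ (a := 0)) ▸ (Multiset.count_le_card _ _).trans
      (Polynomial.card_roots' φ)
  obtain ⟨q, hq, hndvd⟩ := Polynomial.exists_eq_pow_rootMultiplicity_mul_and_not_dvd φ hφ 0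
  obtain ⟨m, hm⟩ := Nat.exists_eq_add_of_le hn
  rw [Nat.succ_eq_add_one, one_add_one_eq_two, add_comm] at hm
  rw [hm] at hq hle
  rw [Polynomial.C_0, sub_zero] at hq hndvd
  have d1 : φ.derivative = Polynomial.X ^ (m + 1) *
      (((m + 2 : ℕ) : Polynomial R) * q + Polynomial.X * q.derivative) := by
    rw [hq, Polynomial.derivative_mul, Polynomial.derivative_X_pow, Polynomial.C_eq_natCast]
    simp only [show m + 2 - 1 = m + 1 from rfl]
    ring
  have d2 : φ.derivative.derivative = Polynomial.X ^ m *
      (((m + 1 : ℕ) : Polynomial R) * ((m + 2 : ℕ) : Polynomial R) * q +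
        Polynomial.X * (((m + 1 : ℕ) : Polynomial R) * q.derivative +
        ((m + 2 : ℕ) : Polynomial R) * q.derivative + q.derivative +
        Polynomial.X * q.derivative.derivative)) := by
    rw [d1, Polynomial.derivative_mul, Polynomial.derivative_X_pow, Polynomial.C_eq_natCast]
    simp only [show m + 1 - 1 = m from rfl, Polynomial.derivative_add, Polynomial.derivative_mul,
      Polynomial.derivative_natCast, Polynomial.derivative_X]
    ring
  rw [d2, d1, hq] at h
  have h' : Polynomial.X ^ m * (Q * (Polynomial.X ^ 2 * q)) = Polynomial.X ^ m *
      (P * (((m + 1 : ℕ) : Polynomial R) * ((m + 2 : ℕ) : Polynomial R) * q +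
        Polynomial.X * (((m + 1 : ℕ) : Polynomial R) * q.derivative +
        ((m + 2 : ℕ) : Polynomial R) * q.derivative + q.derivative +
        Polynomial.X * q.derivative.derivative))
      + Polynomial.X * (((m + 2 : ℕ) : Polynomial R) * q + Polynomial.X * q.derivative) * S) := by
    linear_combination h
  have h2 := congrArg (Polynomial.eval 0)
    (mul_left_cancel₀ (pow_ne_zero m Polynomial.X_ne_zero) h')
  simp only [Polynomial.eval_mul, Polynomial.eval_add, Polynomial.eval_pow, Polynomial.eval_X,
    Polynomial.eval_natCast, zero_mul, add_zero, mul_zero, ne_eq, OfNat.ofNat_ne_zero,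
    not_false_eq_true, zero_pow] at h2
  have hq0 : q.eval 0 ≠ 0 := by
    intro hq0
    exact hndvd (by simpa using Polynomial.dvd_iff_isRoot.2 hq0)
  have hc (j : ℕ) (hj : 0 < j) (hj' : j < p) : (j : R) ≠ 0 := by
    rw [Ne, CharP.cast_eq_zero_iff R p]
    exact fun hdv => absurd (Nat.le_of_dvd hj hdv) (by omega)
  exact mul_ne_zero hP (mul_ne_zero (mul_ne_zero (hc _ (by omega) (by omega))
    (hc _ (by omega) (by omega))) hq0) h2.symm

/-- On an irreducible surface which has contact of order two with the planes `X = const` along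
lines, the lines of the second family are collinear. -/
theorem exists_collinear_of_dvd_contact {p : ℕ} [CharP K p] {G : MvPolynomial (Fin 3) K}
    (hG : Irreducible G) (hGH : G ∣ contact G) (hd : G.totalDegree < p) {B₀ : K × K × K}
    (h₀ : lineB B₀ G = 0) (h₁ : lineB B₀ (pderiv 0 G) ≠ 0) :
    ∃ σ₀ σ₁ : K, ∀ B, lineB B G = 0 → B.2.1 = B₀.2.1 + σ₀ * (B.1 - B₀.1) ∧
      B.2.2 = B₀.2.2 + σ₁ * (B.1 - B₀.1) := by
  obtain ⟨b₀, y₀, t₀⟩ := B₀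
  set D := lineB (b₀, y₀, t₀) (pderiv 0 G) with hD
  set N := - lineB (b₀, y₀, t₀) (pderiv 1 G) with hN
  let v : Fin 3 → Polynomial (Polynomial K) :=
    ![Polynomial.C (Polynomial.C y₀ + Polynomial.C t₀ * Polynomial.X) +
        Polynomial.C N * Polynomial.X,
      Polynomial.C (Polynomial.C b₀) + Polynomial.C D * Polynomial.X,
      Polynomial.C Polynomial.X]
  let θ : MvPolynomial (Fin 3) K →ₐ[K] Polynomial (Polynomial K) := aeval v
  have hθd (F : MvPolynomial (Fin 3) K) : Polynomial.derivative (θ F) =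
      θ (pderiv 0 F) * Polynomial.C N + θ (pderiv 1 F) * Polynomial.C D := by
    have := derivation_aeval (K := K)
      ((Polynomial.derivative' (R := Polynomial K)).restrictScalars K) v F
    simpa [Fin.sum_univ_three, θ, Polynomial.derivative', v] using this
  have hθ0 (F : MvPolynomial (Fin 3) K) : (θ F).eval 0 = lineB (b₀, y₀, t₀) F := by
    have : ((Polynomial.aeval (0 : Polynomial K)).restrictScalars K).comp θ =
        lineB (b₀, y₀, t₀) := by
      refine algHom_ext fun i => ?_
      fin_cases i <;> simp [θ, v, lineB]
    have := DFunLike.congr_fun this F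
    simpa [Polynomial.aeval_def] using this
  have hθG : θ G = 0 := by
    obtain ⟨Q, hQ⟩ := hGH
    have hφ1 := hθd G
    have hφ2 : Polynomial.derivative (Polynomial.derivative (θ G)) =
        (θ (pderiv 0 (pderiv 0 G)) * Polynomial.C N + θ (pderiv 1 (pderiv 0 G)) * Polynomial.C D)
          * Polynomial.C N + (θ (pderiv 0 (pderiv 1 G)) * Polynomial.C N +
          θ (pderiv 1 (pderiv 1 G)) * Polynomial.C D) * Polynomial.C D := by
      rw [hθd G]
      simp only [Polynomial.derivative_add, Polynomial.derivative_mul, hθd,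
        Polynomial.derivative_C, mul_zero, add_zero]
    rw [pderiv_comm 1 0] at hφ2
    have hH := congrArg θ hQ
    simp only [contact, map_add, map_sub, map_mul, map_pow, map_ofNat] at hH
    refine eq_zero_of_ode (p := p) (P := θ (pderiv 0 G) ^ 2) (Q := Polynomial.C D ^ 2 * θ Q)
      (S := -2 * Polynomial.C D * θ (pderiv 0 (pderiv 1 G)) * θ (pderiv 0 G)
        + θ (pderiv 0 (pderiv 0 G)) * Polynomial.derivative (θ G)
        - 2 * Polynomial.C N * θ (pderiv 0 (pderiv 0 G)) * θ (pderiv 0 G)) ?_ ?_ ?_ ?_ ?_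
    · rw [hθ0, h₀]
    · rw [hφ1]
      simp only [Polynomial.eval_add, Polynomial.eval_mul, hθ0, Polynomial.eval_C, hN]
      rw [← hD]; ring
    · rw [Polynomial.eval_pow, hθ0]
      exact pow_ne_zero 2 h₁
    · refine lt_of_le_of_lt (natDegree_aeval_le G v fun i => ?_) hd
      fin_cases i
      · exact natDegree_C_add_C_mul_X_le _ _
      · exact natDegree_C_add_C_mul_X_le _ _
      · simp [v]
    · rw [hφ2, hφ1]
      generalize θ Q = Q', Polynomial.C D = D', Polynomial.C N = N',
        θ (pderiv 0 (pderiv 0 G)) = gzz, θ (pderiv 0 (pderiv 1 G)) = gzy,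
        θ (pderiv 1 (pderiv 1 G)) = gyy, θ (pderiv 0 G) = gz, θ (pderiv 1 G) = gy,
        θ G = g at hH ⊢
      linear_combination (-D' ^ 2) * hH
  have hd0 : G.degreeOf 0 ≠ 0 := by
    intro h
    refine h₁ ?_
    rw [hD, pderiv_eq_zero_of_notMem_vars, map_zero]
    rwa [degreeOf_def, Multiset.count_eq_zero, ← Multiset.mem_toFinset, ← vars_def] at h
  let ι : Polynomial K →ₐ[K] MvPolynomial (Fin 3) K := Polynomial.aeval (X 2)
  let Ψ : MvPolynomial (Fin 3) K :=
    ι D * (X 0 - C y₀ - C t₀ * X 2) - ι N * (X 1 - C b₀)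
  have hθι (q : Polynomial K) : θ (ι q) = Polynomial.C q := by
    have : (θ.comp ι) = (Polynomial.CAlgHom (R := Polynomial K)).restrictScalars K := by
      refine Polynomial.algHom_ext ?_
      simp [θ, v, ι, Polynomial.CAlgHom]
    exact DFunLike.congr_fun this q
  have hGΨ : G ∣ Ψ := by
    by_contra hn
    obtain ⟨R, hR, -, hφ⟩ := exists_bivariate_eliminant (Equiv.refl _) hG hd0 hn
    have := hφ θ hθG (by
      simp only [Ψ, map_sub, map_mul, hθι]
      simp [θ, v]
      ring)
    simp only [Equiv.refl_apply, θ, aeval_X] at this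
    have e : (Polynomial.aeval (v 2)).toRingHom = (Polynomial.C : Polynomial K →+* _) := by
      ext <;> simp [v]
    rw [e] at this
    change R.comp (v 1) = 0 at this
    rw [Polynomial.comp_eq_zero_iff] at this
    rcases this with h | ⟨-, h⟩
    · exact hR h
    · have := congrArg (fun q => Polynomial.coeff q 1) h
      simp [v] at this
      exact h₁ this
  have hline (B : K × K × K) (hB : lineB B G = 0) :
      D * (Polynomial.C (B.2.1 - y₀) + Polynomial.C (B.2.2 - t₀) * Polynomial.X) =
        N * Polynomial.C (B.1 - b₀) := by
    obtain ⟨Q, hQ⟩ := hGΨ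
    have h := congrArg (lineB B) hQ
    rw [map_mul, hB, zero_mul] at h
    have hBι (q : Polynomial K) : lineB B (ι q) = q := by
      have : (lineB B).comp ι = AlgHom.id K _ := by
        refine Polynomial.algHom_ext ?_
        simp [lineB, ι]
      exact DFunLike.congr_fun this q
    simp only [Ψ, map_sub, map_mul, hBι] at h
    simp only [lineB, aeval_X, algHom_C, Matrix.cons_val, Polynomial.algebraMap_eq] at h
    simp only [map_sub]
    linear_combination h
  have hlin {u w : K} (h : D * (Polynomial.C u + Polynomial.C w * Polynomial.X) = 0) :
      u = 0 ∧ w = 0 := by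
    have := (mul_eq_zero.1 h).resolve_left h₁
    constructor
    · simpa using congrArg (fun q => Polynomial.coeff q 0) this
    · simpa using congrArg (fun q => Polynomial.coeff q 1) this
  by_cases hex : ∃ B, lineB B G = 0 ∧ B.1 ≠ b₀
  · obtain ⟨B', hB', hb'⟩ := hex
    have hb : B'.1 - b₀ ≠ 0 := sub_ne_zero.2 hb'
    refine ⟨(B'.2.1 - y₀) / (B'.1 - b₀), (B'.2.2 - t₀) / (B'.1 - b₀), fun B hB => ?_⟩
    have key := hlin (u := (B'.1 - b₀) * (B.2.1 - y₀) - (B.1 - b₀) * (B'.2.1 - y₀))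
      (w := (B'.1 - b₀) * (B.2.2 - t₀) - (B.1 - b₀) * (B'.2.2 - t₀)) (by
        have e1 := hline B hB
        have e2 := hline B' hB'
        simp only [map_sub, map_mul] at e1 e2 ⊢
        linear_combination (Polynomial.C B'.1 - Polynomial.C b₀) * e1
          - (Polynomial.C B.1 - Polynomial.C b₀) * e2)
    constructor
    · field_simp
      linear_combination key.1
    · field_simp
      linear_combination key.2
  · push Not at hex
    refine ⟨0, 0, fun B hB => ?_⟩
    have e1 := hline B hB
    rw [hex B hB, sub_self, map_zero, mul_zero] at e1
    have := hlin e1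
    constructor
    · linear_combination this.1
    · linear_combination this.2

end Surfaces

section Crossings
open MvPolynomial

variable {K : Type u} [Field K] [DecidableEq K]

/-- The number of pairs of crossing lines. -/
def crossings (𝒜 ℬ : Finset (K × K × K)) : ℕ := ∑ B ∈ ℬ, (𝒜.filter fun A => Cross A B).card

theorem crossings_le_of_forall_le {𝒜 ℬ : Finset (K × K × K)} {n : ℕ}
    (h : ∀ B ∈ ℬ, (𝒜.filter fun A => Cross A B).card ≤ n) : crossings 𝒜 ℬ ≤ n * ℬ.card := by
  rw [mul_comm]
  exact Finset.sum_le_card_nsmul _ _ _ h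

theorem crossings_mono (𝒜 : Finset (K × K × K)) {ℬ ℬ' : Finset (K × K × K)} (h : ℬ ⊆ ℬ') :
    crossings 𝒜 ℬ ≤ crossings 𝒜 ℬ' :=
  Finset.sum_le_sum_of_subset h

theorem crossings_filter_add (𝒜 ℬ : Finset (K × K × K)) (P : K × K × K → Prop)
    [DecidablePred P] :
    crossings 𝒜 (ℬ.filter P) + crossings 𝒜 (ℬ.filter fun B => ¬ P B) = crossings 𝒜 ℬ :=
  Finset.sum_filter_add_sum_filter_not _ _ _

theorem crossings_filter_add_left (𝒜 ℬ : Finset (K × K × K)) (P : K × K × K → Prop)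
    [DecidablePred P] :
    crossings (𝒜.filter P) ℬ + crossings (𝒜.filter fun A => ¬ P A) ℬ = crossings 𝒜 ℬ := by
  rw [crossings, crossings, crossings, ← Finset.sum_add_distrib]
  refine Finset.sum_congr rfl fun B _ => ?_
  rw [Finset.filter_comm, Finset.filter_comm (fun A => ¬ P A),
    Finset.card_filter_add_card_filter_not]

theorem crossings_empty_left (ℬ : Finset (K × K × K)) : crossings ∅ ℬ = 0 := by
  simp [crossings]

/-- Among the lines of the second family, at most `k` are collinear in parameter space. -/
def CollinearBound (ℬ : Finset (K × K × K)) (k : ℕ) : Prop :=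
  ∀ σ₀ σ₁ : K, ∀ B₀ ∈ ℬ, (ℬ.filter fun B => B.2.1 = B₀.2.1 + σ₀ * (B.1 - B₀.1) ∧
    B.2.2 = B₀.2.2 + σ₁ * (B.1 - B₀.1)).card ≤ k

theorem totalDegree_pos_of_irreducible {G : MvPolynomial (Fin 3) K} (hG : Irreducible G) :
    0 < G.totalDegree := by
  rw [Nat.pos_iff_ne_zero]
  intro h
  have := totalDegree_eq_zero_iff_eq_C.1 h
  by_cases h0 : coeff 0 G = 0
  · rw [h0, C_0] at this
    exact hG.ne_zero this
  · apply hG.not_isUnit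
    rw [this]
    exact (isUnit_iff_ne_zero.2 h0).map C

theorem exists_bad_of_irreducible {p : ℕ} [CharP K p] {G : MvPolynomial (Fin 3) K}
    (hG : Irreducible G) (hd : G.totalDegree < p) {𝒜 ℬ : Finset (K × K × K)} {k : ℕ}
    (hA : ∀ A ∈ 𝒜, ∀ A' ∈ 𝒜, A.1 = A'.1 → A.2.2 = A'.2.2)
    (hB : ∀ B ∈ ℬ, ∀ B' ∈ ℬ, B.2 = B'.2 → B = B') (hk : CollinearBound ℬ k)
    (hAG : ∀ A ∈ 𝒜, lineA A G = 0) :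
    ∃ bad ⊆ ℬ, bad.card ≤ 12 * G.totalDegree ^ 2 ∧
      crossings 𝒜 (ℬ \ bad) ≤ 3 * G.totalDegree * ℬ.card + k * 𝒜.card := by
  classical
  have hpos := totalDegree_pos_of_irreducible hG
  have hbez (H : MvPolynomial (Fin 3) K) (hH : ¬ G ∣ H) (hHd : H.totalDegree ≤ 3 * G.totalDegree) :
      (ℬ.filter fun B => lineB B G = 0 ∧ lineB B H = 0).card ≤ 12 * G.totalDegree ^ 2 := by
    have h1 := card_le_of_lineB_eq_zero hG hH
      (ℬ := ℬ.filter fun B => lineB B G = 0 ∧ lineB B H = 0)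
      (fun B h B' h' => hB B (Finset.mem_filter.1 h).1 B' (Finset.mem_filter.1 h').1)
      (fun B h => (Finset.mem_filter.1 h).2.1) (fun B h => (Finset.mem_filter.1 h).2.2)
    have h2 := Nat.mul_le_mul_left G.totalDegree hHd
    nlinarith
  have hGle (B : K × K × K) (h : lineB B G ≠ 0) :
      (𝒜.filter fun A => Cross A B).card ≤ 3 * G.totalDegree :=
    (card_cross_le hA hAG h).trans (by omega)
  have hbound {ℬ' : Finset (K × K × K)} (hs : ℬ' ⊆ ℬ)
      (h : ∀ B ∈ ℬ', (𝒜.filter fun A => Cross A B).card ≤ 3 * G.totalDegree) :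
      crossings 𝒜 ℬ' ≤ 3 * G.totalDegree * ℬ.card :=
    (crossings_le_of_forall_le h).trans (Nat.mul_le_mul_left _ (Finset.card_le_card hs))
  by_cases hGH : G ∣ contact G
  · by_cases hZ : pderiv 0 G = 0
    · refine ⟨∅, Finset.empty_subset _, by simp, ?_⟩
      rw [Finset.sdiff_empty]
      refine (hbound subset_rfl fun B _ => ?_).trans (Nat.le_add_right _ _)
      by_cases h : lineB B G = 0
      · rcases 𝒜.eq_empty_or_nonempty with rfl | ⟨A, hAm⟩
        · simp
        · exfalso
          have hdvd := dvd_of_lineA_eq_zero (hAG A hAm) (notMem_vars_of_pderiv_eq_zero hZ hd)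
          rcases hG.dvd_iff.1 hdvd with hu | ha
          · have := hu.map (lineA A)
            simp [lineA] at this
          · obtain ⟨c, hc⟩ := ha.dvd
            have h1 := congrArg (lineB B) hc
            rw [map_mul, h, zero_mul] at h1
            simp only [lineB, map_sub, aeval_X, algHom_C, Matrix.cons_val,
              Polynomial.algebraMap_eq] at h1
            exact Polynomial.X_sub_C_ne_zero A.1 h1
      · exact hGle B h
    · have hnd : ¬ G ∣ pderiv 0 G := fun h =>
        absurd (totalDegree_le_of_dvd_of_isDomain h hZ) (not_le.2 (totalDegree_pderiv_lt hZ))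
      refine ⟨_, Finset.filter_subset _ _,
        hbez _ hnd ((totalDegree_pderiv_le 0 G).trans (by omega)), ?_⟩
      rw [← crossings_filter_add _ _ (fun B => lineB B G ≠ 0)]
      refine add_le_add (hbound ((Finset.filter_subset _ _).trans Finset.sdiff_subset)
        fun B h => hGle B (Finset.mem_filter.1 h).2) ?_
      set 𝒮 := (ℬ \ ℬ.filter fun B => lineB B G = 0 ∧ lineB B (pderiv 0 G) = 0).filter
        fun B => ¬ lineB B G ≠ 0
      have h𝒮 : ∀ B ∈ 𝒮, B ∈ ℬ ∧ lineB B G = 0 ∧ lineB B (pderiv 0 G) ≠ 0 := by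
        intro B h
        simp only [𝒮, Finset.mem_filter, Finset.mem_sdiff, not_not] at h
        tauto
      have h1 : 𝒮.card ≤ k := by
        rcases 𝒮.eq_empty_or_nonempty with h | ⟨B₀, hB₀⟩
        · simp [h]
        · obtain ⟨σ₀, σ₁, hσ⟩ := exists_collinear_of_dvd_contact hG hGH hd (h𝒮 B₀ hB₀).2.1
            (h𝒮 B₀ hB₀).2.2
          refine (Finset.card_le_card fun B h => ?_).trans (hk σ₀ σ₁ B₀ (h𝒮 B₀ hB₀).1)
          exact Finset.mem_filter.2 ⟨(h𝒮 B h).1, hσ B (h𝒮 B h).2.1⟩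
      refine (crossings_le_of_forall_le fun B _ => Finset.card_filter_le _ _).trans ?_
      rw [mul_comm]
      exact Nat.mul_le_mul_right _ h1
  · refine ⟨_, Finset.filter_subset _ _, hbez _ hGH (totalDegree_contact_le G), ?_⟩
    refine (hbound Finset.sdiff_subset fun B h => ?_).trans (Nat.le_add_right _ _)
    simp only [Finset.mem_sdiff, Finset.mem_filter, not_and] at h
    by_cases h0 : lineB B G = 0
    · exact (card_cross_le hA (fun A hAm => lineA_contact (hAG A hAm)) (h.2 h.1 h0)).trans
        (totalDegree_contact_le G)
    · exact hGle B h0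

theorem exists_bad_of_lineA_eq_zero {p : ℕ} [CharP K p] {F : MvPolynomial (Fin 3) K}
    (hF : F ≠ 0) (hd : F.totalDegree < p) {𝒜 ℬ : Finset (K × K × K)} {k : ℕ}
    (hA : ∀ A ∈ 𝒜, ∀ A' ∈ 𝒜, A.1 = A'.1 → A.2.2 = A'.2.2)
    (hB : ∀ B ∈ ℬ, ∀ B' ∈ ℬ, B.2 = B'.2 → B = B') (hk : CollinearBound ℬ k)
    (hAF : ∀ A ∈ 𝒜, lineA A F = 0) :
    ∃ bad ⊆ ℬ, bad.card ≤ 12 * F.totalDegree ^ 2 ∧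
      crossings 𝒜 (ℬ \ bad) ≤ 3 * F.totalDegree * ℬ.card + k * 𝒜.card := by
  classical
  induction F using WfDvdMonoid.induction_on_irreducible generalizing 𝒜 with
  | zero => exact absurd rfl hF
  | unit u hu =>
    have : 𝒜 = ∅ := by
      rw [Finset.eq_empty_iff_forall_notMem]
      intro A hAm
      exact (hu.map (lineA A)).ne_zero (hAF A hAm)
    subst this
    exact ⟨∅, Finset.empty_subset _, by simp, by simp [crossings_empty_left]⟩
  | mul F G hF0 hG ih =>
    rw [totalDegree_mul_of_isDomain hG.ne_zero hF0] at hd ⊢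
    obtain ⟨bad₁, hs₁, hc₁, hI₁⟩ := exists_bad_of_irreducible hG (by omega)
      (𝒜 := 𝒜.filter fun A => lineA A G = 0)
      (fun A h A' h' => hA A (Finset.mem_filter.1 h).1 A' (Finset.mem_filter.1 h').1) hB hk
      (fun A h => (Finset.mem_filter.1 h).2)
    obtain ⟨bad₂, hs₂, hc₂, hI₂⟩ := ih hF0 (by omega)
      (𝒜 := 𝒜.filter fun A => ¬ lineA A G = 0)
      (fun A h A' h' => hA A (Finset.mem_filter.1 h).1 A' (Finset.mem_filter.1 h').1)
      (fun A h => by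
        have h1 := Finset.mem_filter.1 h
        have h2 := hAF A h1.1
        rw [map_mul] at h2
        exact (mul_eq_zero.1 h2).resolve_left h1.2)
    refine ⟨bad₁ ∪ bad₂, Finset.union_subset hs₁ hs₂, ?_, ?_⟩
    · have := Finset.card_union_le bad₁ bad₂
      nlinarith
    · rw [← crossings_filter_add_left 𝒜 _ (fun A => lineA A G = 0),
        ← Finset.card_filter_add_card_filter_not (s := 𝒜) (fun A => lineA A G = 0)]
      have h1 := crossings_mono (𝒜.filter fun A => lineA A G = 0)
        (Finset.sdiff_subset_sdiff (subset_refl ℬ)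
          (Finset.subset_union_left (s₁ := bad₁) (s₂ := bad₂)))
      have h2 := crossings_mono (𝒜.filter fun A => ¬ lineA A G = 0)
        (Finset.sdiff_subset_sdiff (subset_refl ℬ)
          (Finset.subset_union_right (s₁ := bad₁) (s₂ := bad₂)))
      nlinarith

theorem exists_bad {p : ℕ} [CharP K p] {𝒜 ℬ : Finset (K × K × K)} {k : ℕ}
    (hp : 3 * Nat.sqrt (3 * 𝒜.card) < p)
    (hA : ∀ A ∈ 𝒜, ∀ A' ∈ 𝒜, A.1 = A'.1 → A.2.2 = A'.2.2)
    (hB : ∀ B ∈ ℬ, ∀ B' ∈ ℬ, B.2 = B'.2 → B = B') (hk : CollinearBound ℬ k) :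
    ∃ bad ⊆ ℬ, bad.card ≤ 324 * 𝒜.card ∧
      crossings 𝒜 (ℬ \ bad) ≤ 9 * Nat.sqrt (3 * 𝒜.card) * ℬ.card + k * 𝒜.card := by
  set e := Nat.sqrt (3 * 𝒜.card)
  have h1 : e * e ≤ 3 * 𝒜.card := Nat.sqrt_le _
  have h2 : 3 * 𝒜.card < (e + 1) * (e + 1) := Nat.lt_succ_sqrt _
  obtain ⟨F, hF0, hFd, hAF⟩ := exists_lineA_eq_zero 𝒜 (e := e) (by nlinarith)
  obtain ⟨bad, hs, hc, hI⟩ := exists_bad_of_lineA_eq_zero hF0 (hFd.trans_lt hp) hA hB hk hAF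
  refine ⟨bad, hs, ?_, hI.trans ?_⟩
  · nlinarith
  · exact Nat.add_le_add_right (Nat.mul_le_mul_right _ (by omega)) _

end Crossings

section ShiftedEnergy

theorem CollinearBound.mono {K : Type u} [Field K] [DecidableEq K] {ℬ ℬ' : Finset (K × K × K)}
    {k : ℕ} (h : CollinearBound ℬ k) (hs : ℬ' ⊆ ℬ) : CollinearBound ℬ' k :=
  fun σ₀ σ₁ B₀ hB₀ =>
    (Finset.card_le_card (Finset.filter_subset_filter _ hs)).trans (h σ₀ σ₁ B₀ (hs hB₀))

variable {F : Type*} {K : Type u} [Field F] [Field K] [Algebra F K]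

/-- The line of the first family attached to `(γ₁, x₁, x₃)`. -/
def firstLine (τ : K) (q : F × F × F) : K × K × K :=
  (algebraMap F K q.1 + τ * algebraMap F K q.2.2, algebraMap F K q.2.1,
    τ - algebraMap F K q.2.2)

/-- The line of the second family attached to `(γ₂, x₂, x₄)`. -/
def secondLine (τ : K) (q : F × F × F) : K × K × K :=
  (algebraMap F K q.1 + τ * algebraMap F K q.2.1,
    algebraMap F K q.2.2 + τ * (algebraMap F K q.1 + τ * algebraMap F K q.2.1),
    -algebraMap F K q.2.1)

theorem cross_firstLine_secondLine {τ : K} {γ₁ x₁ x₃ γ₂ x₂ x₄ : F} :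
    Cross (firstLine τ (γ₁, x₁, x₃)) (secondLine τ (γ₂, x₂, x₄)) ↔
      x₁ + γ₁ * x₂ = x₄ + γ₂ * x₃ := by
  rw [← (algebraMap F K).injective.eq_iff]
  simp only [Cross, firstLine, secondLine, map_add, map_mul]
  constructor <;> intro h <;> linear_combination h

theorem eq_and_eq_of_add_mul_eq {τ : K} (hτ : τ ∉ Set.range (algebraMap F K)) {a b c d : F}
    (h : algebraMap F K a + τ * algebraMap F K b = algebraMap F K c + τ * algebraMap F K d) :
    a = c ∧ b = d := by
  have hb : b = d := by
    by_contra hne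
    have hne' : algebraMap F K b - algebraMap F K d ≠ 0 :=
      sub_ne_zero.2 fun e => hne ((algebraMap F K).injective e)
    refine hτ ⟨(c - a) / (b - d), ?_⟩
    rw [map_div₀, map_sub, map_sub]
    field_simp
    linear_combination -h
  subst hb
  exact ⟨(algebraMap F K).injective (add_right_cancel h), rfl⟩

theorem firstLine_injective {τ : K} (hτ : τ ∉ Set.range (algebraMap F K)) :
    Function.Injective (firstLine τ : F × F × F → K × K × K) := by
  rintro ⟨γ, x, z⟩ ⟨γ', x', z'⟩ h
  simp only [firstLine, Prod.mk.injEq] at h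
  obtain ⟨rfl, rfl⟩ := eq_and_eq_of_add_mul_eq hτ h.1
  rw [(algebraMap F K).injective h.2.1]

theorem secondLine_snd_injective {τ : K} (hτ : τ ∉ Set.range (algebraMap F K)) {q q' : F × F × F}
    (h : (secondLine τ q).2 = (secondLine τ q').2) : q = q' := by
  obtain ⟨γ, x, z⟩ := q
  obtain ⟨γ', x', z'⟩ := q'
  simp only [secondLine, Prod.mk.injEq, neg_inj, (algebraMap F K).injective.eq_iff] at h
  obtain ⟨h1, rfl⟩ := h
  obtain ⟨rfl, rfl⟩ := eq_and_eq_of_add_mul_eq (a := z) (b := γ) (c := z') (d := γ') hτ (by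
    linear_combination h1)
  rfl

variable [DecidableEq K]

theorem collinearBound_secondLine {τ : K} (hτ : τ ∉ Set.range (algebraMap F K)) {G P : Finset F}
    (hGP : G.card ≤ P.card) :
    CollinearBound ((G ×ˢ P ×ˢ P).image (secondLine τ)) P.card := by
  intro σ₀ σ₁ B₀ hB₀
  obtain ⟨⟨γ₀, x₀, z₀⟩, -, rfl⟩ := Finset.mem_image.1 hB₀
  rw [Finset.filter_image]
  refine Finset.card_image_le.trans ?_
  set j := algebraMap F K
  set T := (G ×ˢ P ×ˢ P).filter fun q => (secondLine τ q).2.1 = (secondLine τ (γ₀, x₀, z₀)).2.1 +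
    σ₀ * ((secondLine τ q).1 - (secondLine τ (γ₀, x₀, z₀)).1) ∧
    (secondLine τ q).2.2 = (secondLine τ (γ₀, x₀, z₀)).2.2 +
    σ₁ * ((secondLine τ q).1 - (secondLine τ (γ₀, x₀, z₀)).1) with hT
  have hmem : ∀ q ∈ T, (q.1 ∈ G ∧ q.2.1 ∈ P ∧ q.2.2 ∈ P) ∧
      (secondLine τ q).2.1 = (secondLine τ (γ₀, x₀, z₀)).2.1 +
      σ₀ * ((secondLine τ q).1 - (secondLine τ (γ₀, x₀, z₀)).1) ∧
      (secondLine τ q).2.2 = (secondLine τ (γ₀, x₀, z₀)).2.2 +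
      σ₁ * ((secondLine τ q).1 - (secondLine τ (γ₀, x₀, z₀)).1) := by
    intro q hq
    simpa only [hT, Finset.mem_filter, Finset.mem_product] using hq
  have hfst {q q' : F × F × F} (hq : q ∈ T) (hq' : q' ∈ T)
      (h : (secondLine τ q).1 = (secondLine τ q').1) : q = q' := by
    obtain ⟨-, h1, h2⟩ := hmem q hq
    obtain ⟨-, h1', h2'⟩ := hmem q' hq'
    rw [← h] at h1' h2'
    exact secondLine_snd_injective hτ (Prod.ext (h1.trans h1'.symm) (h2.trans h2'.symm))
  by_cases hσ₁ : σ₁ = 0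
  · have hx : ∀ q ∈ T, q.2.1 = x₀ := by
      intro q hq
      have h2 := (hmem q hq).2.2
      rw [hσ₁, zero_mul, add_zero] at h2
      simp only [secondLine, neg_inj] at h2
      exact j.injective h2
    have hz : ∀ q ∈ T, j q.2.2 - j z₀ = (σ₀ - τ) * (j q.1 - j γ₀) := by
      intro q hq
      have h1 := (hmem q hq).2.1
      simp only [secondLine, hx q hq] at h1
      linear_combination h1
    by_cases hσ₀ : σ₀ = τ
    · refine le_trans (Finset.card_le_card_of_injOn (fun q => q.1)
        (fun q hq => (hmem q hq).1.1) ?_) hGP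
      intro q hq q' hq' h
      have h1 := hz q hq
      have h2 := hz q' hq'
      rw [hσ₀, sub_self, zero_mul, sub_eq_zero] at h1 h2
      exact Prod.ext h (Prod.ext ((hx q hq).trans (hx q' hq').symm)
        (j.injective (h1.trans h2.symm)))
    · refine Finset.card_le_card_of_injOn (fun q => q.2.2) (fun q hq => (hmem q hq).1.2.2) ?_
      intro q hq q' hq' h
      have h1 := hz q hq
      have h2 := hz q' hq'
      simp only at h
      rw [h, h2] at h1
      have h3 := mul_left_cancel₀ (sub_ne_zero.2 hσ₀) h1
      have h4 : q.1 = q'.1 := j.injective (by linear_combination -h3)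
      exact Prod.ext h4 (Prod.ext ((hx q hq).trans (hx q' hq').symm) h)
  · refine Finset.card_le_card_of_injOn (fun q => q.2.1) (fun q hq => (hmem q hq).1.2.1) ?_
    intro q hq q' hq' h
    have h2 := (hmem q hq).2.2
    have h2' := (hmem q' hq').2.2
    refine hfst hq hq' (mul_left_cancel₀ hσ₁ ?_)
    have h3 : (secondLine τ q).2.2 = (secondLine τ q').2.2 := by
      simp only [secondLine]
      simp only at h
      rw [h]
    linear_combination h3 - h2 + h2'

variable [DecidableEq F]

theorem crossings_firstLine_le {p : ℕ} [CharP K p] {τ : K} (hτ : τ ∉ Set.range (algebraMap F K))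
    {G P : Finset F} (hGP : G.card ≤ P.card) {G' : Finset F} (hG' : G'.Nonempty)
    (hp : 27 * (P.card ^ 2 * G'.card) < p ^ 2) {ℬ : Finset (K × K × K)}
    (hℬ : ℬ ⊆ (G ×ˢ P ×ˢ P).image (secondLine τ)) (hc : ℬ.card ≤ 972 * (P.card ^ 2 * G'.card)) :
    (crossings ((G' ×ˢ P ×ˢ P).image (firstLine τ)) ℬ : ℝ) ≤
      10 ^ 5 * (P.card : ℝ) ^ 3 * (G'.card * √(G'.card)) := by
  induction hn : G'.card using Nat.strong_induction_on generalizing G' ℬ with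
  | _ g ih =>
  subst hn
  set n := P.card
  set g := G'.card
  have hg : 0 < g := hG'.card_pos
  have hcard : ((G' ×ˢ P ×ˢ P).image (firstLine τ)).card = n ^ 2 * g := by
    rw [Finset.card_image_of_injective _ (firstLine_injective hτ), Finset.card_product,
      Finset.card_product]
    ring
  rcases (Nat.succ_le_of_lt hg).eq_or_lt with h1 | h1
  · have h1' : g = 1 := h1.symm
    obtain ⟨γ₁, hγ₁⟩ := Finset.card_eq_one.1 h1'
    have hle : crossings ((G' ×ˢ P ×ˢ P).image (firstLine τ)) ℬ ≤ n * ℬ.card := by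
      refine crossings_le_of_forall_le fun B hB => ?_
      obtain ⟨⟨γ₂, x₂, x₄⟩, -, rfl⟩ := Finset.mem_image.1 (hℬ hB)
      rw [Finset.filter_image]
      refine Finset.card_image_le.trans ?_
      refine Finset.card_le_card_of_injOn (fun q => q.2.2) ?_ ?_
      · intro q hq
        simp only [Finset.coe_filter, Finset.mem_product, Set.mem_ofPred_eq] at hq
        exact hq.1.2.2
      · rintro ⟨γ, x, z⟩ hq ⟨γ', x', z'⟩ hq' h
        simp only [Finset.coe_filter, Finset.mem_product, Set.mem_ofPred_eq, hγ₁,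
          Finset.mem_singleton, cross_firstLine_secondLine] at hq hq' h
        obtain ⟨⟨rfl, -⟩, h3⟩ := hq
        obtain ⟨⟨rfl, -⟩, h3'⟩ := hq'
        subst h
        rw [add_right_cancel (h3.trans h3'.symm)]
    have h2 : crossings ((G' ×ˢ P ×ˢ P).image (firstLine τ)) ℬ ≤ 972 * n ^ 3 := by
      refine hle.trans ((Nat.mul_le_mul_left _ hc).trans (le_of_eq ?_))
      rw [h1']; ring
    rw [h1', Nat.cast_one, Real.sqrt_one]
    have h3 : (crossings ((G' ×ˢ P ×ˢ P).image (firstLine τ)) ℬ : ℝ) ≤ 972 * (n : ℝ) ^ 3 := by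
      exact_mod_cast h2
    have : (0 : ℝ) ≤ (n : ℝ) ^ 3 := by positivity
    linarith
  · have hsq : Nat.sqrt (3 * (n ^ 2 * g)) * Nat.sqrt (3 * (n ^ 2 * g)) ≤ 3 * (n ^ 2 * g) :=
      Nat.sqrt_le _
    obtain ⟨bad, hbs, hbc, hbI⟩ := exists_bad (p := p)
      (𝒜 := (G' ×ˢ P ×ˢ P).image (firstLine τ)) (ℬ := ℬ) (k := n) (by
        rw [hcard]
        exact lt_of_pow_lt_pow_left₀ 2 (Nat.zero_le _) (by nlinarith))
      (by
        intro A hA A' hA' h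
        obtain ⟨⟨γ, x, z⟩, -, rfl⟩ := Finset.mem_image.1 hA
        obtain ⟨⟨γ', x', z'⟩, -, rfl⟩ := Finset.mem_image.1 hA'
        simp only [firstLine] at h ⊢
        rw [(eq_and_eq_of_add_mul_eq hτ h).2])
      (by
        intro B hB B' hB' h
        obtain ⟨q, -, rfl⟩ := Finset.mem_image.1 (hℬ hB)
        obtain ⟨q', -, rfl⟩ := Finset.mem_image.1 (hℬ hB')
        rw [secondLine_snd_injective hτ h])
      ((collinearBound_secondLine hτ hGP).mono hℬ)
    rw [hcard] at hbc hbI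
    obtain ⟨G₁, hG₁, hG₁c⟩ := Finset.exists_subset_card_eq (s := G') (n := g / 2) (by omega)
    have hG₂c : (G' \ G₁).card = g - g / 2 := by
      rw [Finset.card_sdiff_of_subset hG₁, hG₁c]
    have hhalf (H : Finset F) (hHs : H ⊆ G') (hH : 0 < H.card) (hH' : 3 * H.card ≤ 2 * g)
        (hH3 : g ≤ 3 * H.card) :
        (crossings ((H ×ˢ P ×ˢ P).image (firstLine τ)) bad : ℝ) ≤
          10 ^ 5 * (n : ℝ) ^ 3 * (H.card * (5 / 6 * √g)) := by
      have hm : n ^ 2 * H.card ≤ n ^ 2 * g := Nat.mul_le_mul_left _ (Finset.card_le_card hHs)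
      have := ih H.card (by omega) (Finset.card_pos.1 hH) (by omega) (hbs.trans hℬ)
        (hbc.trans (by nlinarith [Nat.zero_le (n ^ 2)])) rfl
      refine this.trans ?_
      gcongr
      rw [Real.sqrt_le_left (by positivity), mul_pow, Real.sq_sqrt (by positivity)]
      have : (3 : ℝ) * H.card ≤ 2 * g := by exact_mod_cast hH'
      have : (0 : ℝ) ≤ g := by positivity
      linarith
    have e1 := hhalf G₁ hG₁ (by omega) (by omega) (by omega)
    have e2 := hhalf (G' \ G₁) Finset.sdiff_subset (by omega) (by omega) (by omega)
    have hsplit : crossings ((G' ×ˢ P ×ˢ P).image (firstLine τ)) bad ≤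
        crossings ((G₁ ×ˢ P ×ˢ P).image (firstLine τ)) bad +
          crossings (((G' \ G₁) ×ˢ P ×ˢ P).image (firstLine τ)) bad := by
      rw [crossings, crossings, crossings, ← Finset.sum_add_distrib]
      refine Finset.sum_le_sum fun B _ => ?_
      refine le_trans (Finset.card_le_card ?_) (Finset.card_union_le _ _)
      rw [← Finset.filter_union, ← Finset.image_union, ← Finset.union_product,
        Finset.union_sdiff_of_subset hG₁]
    have htot : crossings ((G' ×ˢ P ×ˢ P).image (firstLine τ)) ℬ =
        crossings ((G' ×ˢ P ×ˢ P).image (firstLine τ)) (ℬ \ bad) +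
          crossings ((G' ×ˢ P ×ˢ P).image (firstLine τ)) bad :=
      (Finset.sum_sdiff hbs).symm
    have hsum : (G₁.card : ℝ) + (G' \ G₁).card = g := by
      rw [hG₁c, hG₂c]
      have : g / 2 + (g - g / 2) = g := by omega
      exact_mod_cast this
    have hbad : (crossings ((G' ×ˢ P ×ˢ P).image (firstLine τ)) bad : ℝ) ≤
        10 ^ 5 * (n : ℝ) ^ 3 * (g * (5 / 6 * √g)) := by
      have := (Nat.cast_le (α := ℝ)).2 hsplit
      rw [Nat.cast_add] at this
      refine this.trans ((add_le_add e1 e2).trans (le_of_eq ?_))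
      rw [← hsum]; ring
    have hroot : (9 : ℝ) * Nat.sqrt (3 * (n ^ 2 * g)) ≤ 16 * (n * √g) := by
      have h9 : ((Nat.sqrt (3 * (n ^ 2 * g)) : ℕ) : ℝ) ^ 2 ≤ 3 * ((n : ℝ) ^ 2 * g) := by
        rw [sq]; exact_mod_cast hsq
      refine abs_le_of_sq_le_sq' ?_ (by positivity) |>.2
      rw [mul_pow, mul_pow, mul_pow, Real.sq_sqrt (by positivity)]
      have : (0 : ℝ) ≤ (n : ℝ) ^ 2 * g := by positivity
      nlinarith
    have hgood : (crossings ((G' ×ˢ P ×ˢ P).image (firstLine τ)) (ℬ \ bad) : ℝ) ≤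
        16 * (n * √g) * (972 * ((n : ℝ) ^ 2 * g)) + n * ((n : ℝ) ^ 2 * g) := by
      have h5 : (crossings ((G' ×ˢ P ×ˢ P).image (firstLine τ)) (ℬ \ bad) : ℝ) ≤
          9 * Nat.sqrt (3 * (n ^ 2 * g)) * ℬ.card + n * ((n : ℝ) ^ 2 * g) := by
        exact_mod_cast hbI
      have h6 : (ℬ.card : ℝ) ≤ 972 * ((n : ℝ) ^ 2 * g) := by exact_mod_cast hc
      refine h5.trans (add_le_add (mul_le_mul hroot h6 (by positivity) (by positivity)) le_rfl)
    have h1g : (1 : ℝ) ≤ √g := by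
      rw [Real.one_le_sqrt]
      exact_mod_cast hg
    have hX : (n : ℝ) * ((n : ℝ) ^ 2 * g) ≤ (n : ℝ) ^ 3 * (g * √g) := by
      have : (n : ℝ) * ((n : ℝ) ^ 2 * g) = (n : ℝ) ^ 3 * (g * 1) := by ring
      rw [this]
      gcongr
    have hY : (0 : ℝ) ≤ (n : ℝ) ^ 3 * (g * √g) := by positivity
    rw [htot, Nat.cast_add]
    nlinarith

theorem card_sq_mul_Eplus_le_crossings {τ : K} (hτ : τ ∉ Set.range (algebraMap F K))
    {G P : Finset F} (hG0 : (0 : F) ∉ G) (hGP : ∀ γ ∈ G, ∀ x ∈ P, γ⁻¹ * x ∈ P) :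
    G.card ^ 2 * Eplus P ≤ crossings ((G ×ˢ P ×ˢ P).image (firstLine τ))
      ((G ×ˢ P ×ˢ P).image (secondLine τ)) := by
  have h1 : crossings ((G ×ˢ P ×ˢ P).image (firstLine τ)) ((G ×ˢ P ×ˢ P).image (secondLine τ)) =
      ((((G ×ˢ P ×ˢ P).image (secondLine τ)) ×ˢ ((G ×ˢ P ×ˢ P).image (firstLine τ))).filter
        fun q => Cross q.2 q.1).card := by
    simp only [crossings, Finset.card_filter, Finset.sum_product]
  have h2 : G.card ^ 2 * Eplus P = (G ×ˢ G ×ˢ ((P ×ˢ P ×ˢ P ×ˢ P).filter fun q =>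
      q.1 + q.2.1 = q.2.2.1 + q.2.2.2)).card := by
    rw [Finset.card_product, Finset.card_product, Eplus]; ring
  rw [h1, h2]
  refine Finset.card_le_card_of_injOn (fun q => (secondLine τ (q.2.1, q.1⁻¹ * q.2.2.2.1,
    q.2.2.2.2.1), firstLine τ (q.1, q.2.2.1, q.2.1⁻¹ * q.2.2.2.2.2))) ?_ ?_
  · rintro ⟨γ₁, γ₂, y₁, y₂, y₃, y₄⟩ hq
    simp only [Finset.coe_product, Finset.coe_filter, Set.mem_prod, Finset.mem_coe,
      Finset.mem_product, Set.mem_ofPred_eq] at hq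
    obtain ⟨h1, h2, ⟨h3, h4, h5, h6⟩, h7⟩ := hq
    simp only [Finset.coe_filter, Finset.mem_product, Set.mem_ofPred_eq]
    refine ⟨⟨Finset.mem_image_of_mem _ ?_, Finset.mem_image_of_mem _ ?_⟩, ?_⟩
    · simp only [Finset.mem_product]
      exact ⟨h2, hGP _ h1 _ h4, h5⟩
    · simp only [Finset.mem_product]
      exact ⟨h1, h3, hGP _ h2 _ h6⟩
    · have e1 : γ₁ ≠ 0 := fun h => hG0 (h ▸ h1)
      have e2 : γ₂ ≠ 0 := fun h => hG0 (h ▸ h2)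
      rw [cross_firstLine_secondLine, mul_inv_cancel_left₀ e1, mul_inv_cancel_left₀ e2, h7]
  · rintro ⟨γ₁, γ₂, y₁, y₂, y₃, y₄⟩ hq ⟨γ₁', γ₂', y₁', y₂', y₃', y₄'⟩ - h
    simp only [Finset.coe_product, Finset.coe_filter, Set.mem_prod, Finset.mem_coe,
      Finset.mem_product, Set.mem_ofPred_eq] at hq
    simp only [Prod.mk.injEq] at h
    have h1 := secondLine_snd_injective hτ (congrArg Prod.snd h.1)
    have h2 := firstLine_injective hτ h.2
    simp only [Prod.mk.injEq] at h1 h2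
    obtain ⟨rfl, h1, rfl⟩ := h1
    obtain ⟨rfl, rfl, h2⟩ := h2
    have e1 : γ₁ ≠ 0 := fun h => hG0 (h ▸ hq.1)
    have e2 : γ₂ ≠ 0 := fun h => hG0 (h ▸ hq.2.1)
    rw [mul_left_cancel₀ (inv_ne_zero e1) h1, mul_left_cancel₀ (inv_ne_zero e2) h2]

end ShiftedEnergy

theorem Eplus_mul_sqrt_le {p : ℕ} [Fact p.Prime] {G P : Finset (ZMod p)} (hG : G.Nonempty)
    (hG0 : (0 : ZMod p) ∉ G) (hGP : ∀ γ ∈ G, ∀ x ∈ P, γ⁻¹ * x ∈ P) (hc : G.card ≤ P.card)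
    (hp : 27 * (P.card ^ 2 * G.card) < p ^ 2) :
    (Eplus P : ℝ) * √(G.card) ≤ 10 ^ 5 * (P.card : ℝ) ^ 3 := by
  classical
  let K := AlgebraicClosure (ZMod p)
  have : CharP K p := charP_of_injective_algebraMap (algebraMap (ZMod p) K).injective p
  obtain ⟨τ, hτ⟩ := Infinite.exists_notMem_finset
    (Finset.univ.image (algebraMap (ZMod p) K))
  have hτ' : τ ∉ Set.range (algebraMap (ZMod p) K) := by
    simpa using hτ
  have h1 := card_sq_mul_Eplus_le_crossings hτ' hG0 hGP
  have h2 := crossings_firstLine_le (p := p) hτ' hc hG hp subset_rfl (by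
    refine Finset.card_image_le.trans ?_
    rw [Finset.card_product, Finset.card_product]
    nlinarith [Nat.zero_le (P.card ^ 2 * G.card)])
  have h3 : (G.card : ℝ) ^ 2 * Eplus P ≤ 10 ^ 5 * (P.card : ℝ) ^ 3 * (G.card * √(G.card)) := by
    refine le_trans ?_ h2
    exact_mod_cast h1
  have hg : (0 : ℝ) < G.card := by exact_mod_cast hG.card_pos
  have hs : 0 < √(G.card : ℝ) := Real.sqrt_pos.2 hg
  have hss : √(G.card : ℝ) * √(G.card : ℝ) = G.card := Real.mul_self_sqrt hg.le
  refine le_of_mul_le_mul_right ?_ (mul_pos hg hs)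
  calc (Eplus P : ℝ) * √(G.card) * (G.card * √(G.card))
      = (√(G.card : ℝ) * √(G.card : ℝ)) * G.card * Eplus P := by ring
    _ = (G.card : ℝ) ^ 2 * Eplus P := by rw [hss]; ring
    _ ≤ _ := h3

theorem Eplus_le_card_pow_three {G : Type*} [AddCommGroup G] [DecidableEq G] (P : Finset G) :
    Eplus P ≤ P.card ^ 3 := by
  have h : (P ×ˢ P ×ˢ P).card = P.card ^ 3 := by
    rw [Finset.card_product, Finset.card_product]; ring
  rw [Eplus, ← h]
  refine Finset.card_le_card_of_injOn (fun q => (q.1, q.2.1, q.2.2.1)) ?_ ?_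
  · intro q hq
    simp only [Finset.coe_filter, Finset.mem_product, Set.mem_ofPred_eq] at hq
    simp only [Finset.coe_product, Set.mem_prod, Finset.mem_coe]
    exact ⟨hq.1.1, hq.1.2.1, hq.1.2.2.1⟩
  · rintro ⟨a, b, c, d⟩ hq ⟨a', b', c', d'⟩ hq' h
    simp only [Finset.coe_filter, Set.mem_ofPred_eq] at hq hq'
    simp only [Prod.mk.injEq] at h
    obtain ⟨rfl, rfl, rfl⟩ := h
    rw [add_left_cancel (hq.2.symm.trans hq'.2)]

theorem card_le_card_of_invariant {F : Type*} [Field F] {Γ P : Finset F}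
    (hP : ∀ γ ∈ Γ, ∀ x ∈ P, γ * x ∈ P) (hP0 : (0 : F) ∉ P) (hne : P.Nonempty) :
    Γ.card ≤ P.card := by
  obtain ⟨x, hx⟩ := hne
  have hx0 : x ≠ 0 := fun h => hP0 (h ▸ hx)
  exact Finset.card_le_card_of_injOn (fun γ => γ * x) (fun γ hγ => hP γ hγ x hx)
    fun γ _ γ' _ h => mul_right_cancel₀ hx0 h

theorem Eplus_le_of_invariant {p : ℕ} [Fact p.Prime] {Γ P : Finset (ZMod p)}
    (hΓ : IsMulSubgroup Γ) (hP : ∀ γ ∈ Γ, ∀ x ∈ P, γ * x ∈ P) (hP0 : (0 : ZMod p) ∉ P) :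
    (Eplus P : ℝ) ≤ 10 ^ 6 * ((P.card : ℝ) ^ 4 / p + (P.card : ℝ) ^ 3 / √(Γ.card)) := by
  obtain ⟨hΓ0, hΓ1, -, hΓi⟩ := hΓ
  have hp0 : (0 : ℝ) < p := by exact_mod_cast (Fact.out : p.Prime).pos
  have hg0 : 0 < Γ.card := Finset.card_pos.2 ⟨1, hΓ1⟩
  have hs : 0 < √(Γ.card : ℝ) := Real.sqrt_pos.2 (by exact_mod_cast hg0)
  rcases P.eq_empty_or_nonempty with rfl | hne
  · simp [Eplus]
  have hc := card_le_card_of_invariant hP hP0 hne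
  set n := P.card
  have hn0 : 0 < n := hne.card_pos
  have hA : 0 ≤ (n : ℝ) ^ 4 / p := by positivity
  have hB : 0 ≤ (n : ℝ) ^ 3 / √(Γ.card) := by positivity
  by_cases h1 : 27 * (n ^ 2 * Γ.card) < p ^ 2
  · have := Eplus_mul_sqrt_le ⟨1, hΓ1⟩ hΓ0 (fun γ hγ x hx => hP _ (hΓi γ hγ) x hx) hc h1
    rw [← le_div_iff₀ hs, mul_div_assoc] at this
    linarith
  suffices h : (Eplus P : ℝ) * p ≤ 10 ^ 6 * (n : ℝ) ^ 4 by
    rw [← le_div_iff₀ hp0, mul_div_assoc] at h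
    linarith
  by_cases h2 : p ^ 2 ≤ 27 * n ^ 2
  · have h3 : p ≤ 6 * n :=
      (Nat.pow_le_pow_iff_left two_ne_zero).1 (h2.trans (by rw [mul_pow]; omega))
    have h4 : Eplus P * p ≤ n ^ 3 * (6 * n) :=
      Nat.mul_le_mul (Eplus_le_card_pow_three P) h3
    have h5 : (Eplus P : ℝ) * p ≤ n ^ 3 * (6 * n) := by exact_mod_cast h4
    have h6 : (0 : ℝ) ≤ (n : ℝ) ^ 4 := by positivity
    nlinarith
  · set g := (p ^ 2 - 1) / (27 * n ^ 2)
    have hd : 0 < 27 * n ^ 2 := by positivity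
    have hg1 : 1 ≤ g := by
      rw [Nat.one_le_div_iff hd]; omega
    have hmul : 27 * n ^ 2 * g ≤ p ^ 2 - 1 := Nat.mul_div_le _ _
    have hlt : p ^ 2 - 1 < 27 * n ^ 2 * (g + 1) := Nat.lt_mul_div_succ _ hd
    have hgΓ : g ≤ Γ.card := by
      by_contra! hcon
      have : 27 * n ^ 2 * Γ.card ≤ 27 * n ^ 2 * g := Nat.mul_le_mul_left _ hcon.le
      rw [← mul_assoc] at h1
      omega
    obtain ⟨G, hG, hGc⟩ := Finset.exists_subset_card_eq hgΓ
    have hE := Eplus_mul_sqrt_le (G := G) (P := P) (Finset.card_pos.1 (by omega))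
      (fun h => hΓ0 (hG h)) (fun γ hγ x hx => hP _ (hΓi γ (hG hγ)) x hx) (by omega) (by
        rw [hGc, ← mul_assoc]
        change 27 * n ^ 2 * g < p ^ 2
        omega)
    rw [hGc] at hE
    have hpg : (p : ℝ) ≤ 8 * (n * √g) := by
      refine abs_le_of_sq_le_sq' ?_ (by positivity) |>.2
      rw [mul_pow, mul_pow, Real.sq_sqrt (by positivity)]
      have h5 : p ^ 2 ≤ 54 * (n ^ 2 * g) := by
        have h6 : 27 * n ^ 2 * (g + 1) ≤ 27 * n ^ 2 * (2 * g) := Nat.mul_le_mul_left _ (by omega)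
        have h7 : 27 * n ^ 2 * (2 * g) = 54 * (n ^ 2 * g) := by ring
        omega
      have h6 : (p : ℝ) ^ 2 ≤ 54 * ((n : ℝ) ^ 2 * g) := by exact_mod_cast h5
      have h7 : (0 : ℝ) ≤ (n : ℝ) ^ 2 * g := by positivity
      linarith
    calc (Eplus P : ℝ) * p ≤ Eplus P * (8 * (n * √g)) := by gcongr
      _ = 8 * n * (Eplus P * √g) := by ring
      _ ≤ 8 * n * (10 ^ 5 * (n : ℝ) ^ 3) := by gcongr
      _ ≤ 10 ^ 6 * (n : ℝ) ^ 4 := by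
        have h7 : (0 : ℝ) ≤ (n : ℝ) ^ 4 := by positivity
        nlinarith

theorem card_filter_eq_sum_sq {S α : Type*} [Fintype S] [DecidableEq S] (A : Finset α)
    (φ : α → S) :
    ((A ×ˢ A).filter fun q => φ q.1 = φ q.2).card =
      ∑ s, (A.filter fun a => φ a = s).card ^ 2 := by
  rw [Finset.card_eq_sum_card_fiberwise (f := fun q => φ q.1) (t := univ) (by simp)]
  refine Finset.sum_congr rfl fun s _ => ?_
  rw [sq, ← Finset.card_product]
  congr 1
  ext ⟨a, b⟩
  simp only [Finset.mem_filter, Finset.mem_product]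
  constructor
  · rintro ⟨⟨⟨ha, hb⟩, h⟩, rfl⟩
    exact ⟨⟨ha, rfl⟩, hb, h.symm⟩
  · rintro ⟨⟨ha, rfl⟩, hb, h⟩
    exact ⟨⟨⟨ha, hb⟩, h.symm⟩, rfl⟩

section WeightedEnergy

variable {G : Type*} [AddCommGroup G] [Fintype G]

/-- The additive convolution of two real functions on a finite group. -/
def addConv (f g : G → ℝ) (s : G) : ℝ := ∑ x, f x * g (s - x)

/-- The additive energy of a real function on a finite group. -/
def weightedEnergy (f : G → ℝ) : ℝ := ∑ s, addConv f f s ^ 2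

theorem addConv_nonneg {f g : G → ℝ} (hf : ∀ x, 0 ≤ f x) (hg : ∀ x, 0 ≤ g x) (s : G) :
    0 ≤ addConv f g s :=
  Finset.sum_nonneg fun x _ => mul_nonneg (hf x) (hg _)

theorem sum_addConv (f g : G → ℝ) : ∑ s, addConv f g s = (∑ x, f x) * ∑ x, g x := by
  simp only [addConv]
  rw [Finset.sum_comm, Finset.sum_mul]
  refine Finset.sum_congr rfl fun x _ => ?_
  rw [← Finset.mul_sum]
  congr 1
  exact Fintype.sum_equiv (Equiv.subRight x) _ _ fun s => rfl

theorem sum_addConv_sq (f g : G → ℝ) :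
    ∑ s, addConv f g s ^ 2 = ∑ d, (∑ x, f x * f (x + d)) * ∑ y, g y * g (y + d) := by
  have h1 : ∀ s, addConv f g s ^ 2 =
      ∑ d, ∑ x, f (x + d) * g (s - (x + d)) * (f x * g (s - x)) := by
    intro s
    rw [sq, addConv, Finset.sum_mul_sum, Finset.sum_comm, Finset.sum_comm (s := univ (α := G))]
    rw [Finset.sum_comm]
    rw [Finset.sum_comm (f := fun d x => f (x + d) * g (s - (x + d)) * (f x * g (s - x)))]
    refine Finset.sum_congr rfl fun x _ => ?_
    refine (Fintype.sum_equiv (Equiv.addLeft x) _ _ fun d => ?_).symm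
    rfl
  simp only [h1]
  rw [Finset.sum_comm]
  refine Finset.sum_congr rfl fun d _ => ?_
  rw [Finset.sum_comm, Finset.sum_mul]
  refine Finset.sum_congr rfl fun x _ => ?_
  rw [Finset.mul_sum]
  refine Fintype.sum_equiv (Equiv.subRight (x + d)) _ _ fun s => ?_
  simp only [Equiv.subRight_apply]
  rw [show s - (x + d) + d = s - x by abel]
  ring

theorem weightedEnergy_sum_le {ι : Type*} (I : Finset ι) (f : ι → G → ℝ) :
    weightedEnergy (fun x => ∑ i ∈ I, f i x) ≤
      (I.card : ℝ) ^ 3 * ∑ i ∈ I, weightedEnergy (f i) := by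
  have h1 : ∀ s, addConv (fun x => ∑ i ∈ I, f i x) (fun x => ∑ i ∈ I, f i x) s =
      ∑ q ∈ I ×ˢ I, addConv (f q.1) (f q.2) s := by
    intro s
    simp only [addConv, Finset.sum_mul_sum]
    rw [Finset.sum_comm]
    simp only [Finset.sum_product]
    refine Finset.sum_congr rfl fun i _ => ?_
    rw [Finset.sum_comm]
  have h2 : ∀ i j, ∑ s, addConv (f i) (f j) s ^ 2 ≤
      (weightedEnergy (f i) + weightedEnergy (f j)) / 2 := by
    intro i j
    simp only [weightedEnergy, sum_addConv_sq]
    rw [← Finset.sum_add_distrib, Finset.sum_div]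
    refine Finset.sum_le_sum fun d _ => ?_
    nlinarith [sq_nonneg ((∑ x, f i x * f i (x + d)) - ∑ y, f j y * f j (y + d))]
  calc weightedEnergy (fun x => ∑ i ∈ I, f i x)
      = ∑ s, (∑ q ∈ I ×ˢ I, addConv (f q.1) (f q.2) s) ^ 2 := by
        simp only [weightedEnergy, h1]
    _ ≤ ∑ s, ((I ×ˢ I).card : ℝ) * ∑ q ∈ I ×ˢ I, addConv (f q.1) (f q.2) s ^ 2 :=
        Finset.sum_le_sum fun s _ => sq_sum_le_card_mul_sum_sq
    _ = (I.card : ℝ) ^ 2 * ∑ q ∈ I ×ˢ I, ∑ s, addConv (f q.1) (f q.2) s ^ 2 := by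
        rw [← Finset.mul_sum, Finset.sum_comm, Finset.card_product]; push_cast; ring
    _ ≤ (I.card : ℝ) ^ 2 *
          ∑ q ∈ I ×ˢ I, (weightedEnergy (f q.1) + weightedEnergy (f q.2)) / 2 := by
        gcongr with q _; exact h2 _ _
    _ = (I.card : ℝ) ^ 3 * ∑ i ∈ I, weightedEnergy (f i) := by
        rw [← Finset.sum_div, Finset.sum_add_distrib, Finset.sum_product, Finset.sum_product]
        simp only [Finset.sum_const, nsmul_eq_mul]
        rw [← Finset.mul_sum]
        ring

theorem weightedEnergy_le {f : G → ℝ} (hf : ∀ x, 0 ≤ f x) :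
    weightedEnergy f ≤ (∑ x, f x) ^ 2 * ∑ x, f x ^ 2 := by
  have h1 : ∀ s, addConv f f s ^ 2 ≤ (∑ x, f x) * addConv f (fun x => f x ^ 2) s := by
    intro s
    refine Finset.sum_sq_le_sum_mul_sum_of_sq_le_mul _ (fun x _ => hf x)
      (fun x _ => mul_nonneg (hf x) (sq_nonneg _)) fun x _ => le_of_eq ?_
    ring
  calc weightedEnergy f ≤ ∑ s, (∑ x, f x) * addConv f (fun x => f x ^ 2) s :=
        Finset.sum_le_sum fun s _ => h1 s
    _ = _ := by rw [← Finset.mul_sum, sum_addConv]; ring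

theorem weightedEnergy_mono {f g : G → ℝ} (hf : ∀ x, 0 ≤ f x) (hfg : ∀ x, f x ≤ g x) :
    weightedEnergy f ≤ weightedEnergy g := by
  refine Finset.sum_le_sum fun s _ => pow_le_pow_left₀ (addConv_nonneg hf hf s) ?_ 2
  exact Finset.sum_le_sum fun x _ =>
    mul_le_mul (hfg _) (hfg _) (hf _) ((hf _).trans (hfg _))

theorem weightedEnergy_const_mul (c : ℝ) (f : G → ℝ) :
    weightedEnergy (fun x => c * f x) = c ^ 4 * weightedEnergy f := by
  have h : ∀ s, addConv (fun x => c * f x) (fun x => c * f x) s = c ^ 2 * addConv f f s := by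
    intro s
    rw [addConv, addConv, Finset.mul_sum]
    exact Finset.sum_congr rfl fun x _ => by ring
  simp only [weightedEnergy, h, Finset.mul_sum]
  exact Finset.sum_congr rfl fun s _ => by ring

variable [DecidableEq G]

theorem addConv_indicator (P : Finset G) (s : G) :
    addConv (fun x => if x ∈ P then (1 : ℝ) else 0) (fun x => if x ∈ P then (1 : ℝ) else 0) s =
      ((P ×ˢ P).filter fun q => q.1 + q.2 = s).card := by
  rw [Finset.card_filter, Finset.sum_product]
  push_cast
  rw [addConv, ← Finset.sum_filter_add_sum_filter_not univ (· ∈ P), Finset.filter_mem_eq_inter,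
    Finset.univ_inter, Finset.sum_eq_zero (s := univ.filter (· ∉ P)), add_zero]
  · refine Finset.sum_congr rfl fun x hx => ?_
    rw [if_pos hx, one_mul]
    simp only [← eq_sub_iff_add_eq', Finset.sum_ite_eq']
  · intro x hx
    rw [if_neg (Finset.mem_filter.1 hx).2, zero_mul]

theorem weightedEnergy_indicator (P : Finset G) :
    weightedEnergy (fun x => if x ∈ P then (1 : ℝ) else 0) = Eplus P := by
  have h : Eplus P = (((P ×ˢ P) ×ˢ (P ×ˢ P)).filter fun q =>
      q.1.1 + q.1.2 = q.2.1 + q.2.2).card := by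
    refine Finset.card_equiv (Equiv.prodAssoc G G (G × G)).symm ?_
    rintro ⟨a, b, c, d⟩
    simp [and_assoc]
  rw [h, card_filter_eq_sum_sq (P ×ˢ P) fun q => q.1 + q.2]
  simp only [weightedEnergy, addConv_indicator]
  push_cast
  rfl

/-- The function obtained by convolving the indicator of `A` with itself, with `2 ^ k` factors. -/
def dyadicConv (A : Finset G) : ℕ → G → ℝ
  | 0 => fun x => if x ∈ A then 1 else 0
  | k + 1 => addConv (dyadicConv A k) (dyadicConv A k)

theorem dyadicConv_nonneg (A : Finset G) (k : ℕ) : ∀ x, 0 ≤ dyadicConv A k x := by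
  induction k with
  | zero => intro x; rw [dyadicConv]; positivity
  | succ k ih => exact addConv_nonneg ih ih

theorem sum_dyadicConv (A : Finset G) (k : ℕ) :
    ∑ x, dyadicConv A k x = (A.card : ℝ) ^ 2 ^ k := by
  induction k with
  | zero => simp [dyadicConv]
  | succ k ih => rw [dyadicConv, sum_addConv, ih]; ring

theorem dyadicConv_mul_card_le (A : Finset G) (k : ℕ) (x : G) :
    dyadicConv A k x * A.card ≤ (A.card : ℝ) ^ 2 ^ k := by
  induction k generalizing x with
  | zero =>
    simp only [dyadicConv, pow_zero, pow_one]
    split_ifs <;> simp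
  | succ k ih =>
    rw [dyadicConv, addConv, Finset.sum_mul]
    calc ∑ y, dyadicConv A k y * dyadicConv A k (x - y) * A.card
        ≤ ∑ y, dyadicConv A k y * (A.card : ℝ) ^ 2 ^ k := by
          refine Finset.sum_le_sum fun y _ => ?_
          rw [mul_assoc]
          exact mul_le_mul_of_nonneg_left (ih _) (dyadicConv_nonneg A k y)
      _ = _ := by rw [← Finset.sum_mul, sum_dyadicConv]; ring

theorem card_filter_sum_append (A : Finset G) (m n : ℕ) (s : G) :
    ((Fintype.piFinset fun _ : Fin (m + n) => A).filter fun f => ∑ i, f i = s).card =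
      ∑ x, ((Fintype.piFinset fun _ : Fin m => A).filter fun f => ∑ i, f i = x).card *
        ((Fintype.piFinset fun _ : Fin n => A).filter fun f => ∑ i, f i = s - x).card := by
  have h : ((Fintype.piFinset fun _ : Fin (m + n) => A).filter fun f => ∑ i, f i = s).card =
      (((Fintype.piFinset fun _ : Fin m => A) ×ˢ (Fintype.piFinset fun _ : Fin n => A)).filter
        fun q => ∑ i, q.1 i + ∑ i, q.2 i = s).card := by
    symm
    refine Finset.card_equiv (Fin.appendEquiv m n) ?_
    rintro ⟨f, g⟩
    simp only [Finset.mem_filter, Finset.mem_product, Fintype.mem_piFinset, Fin.appendEquiv_apply,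
      Fin.sum_univ_add, Fin.append_left, Fin.append_right]
    refine and_congr_left fun _ => ⟨fun h i => ?_, fun h => ⟨fun i => ?_, fun i => ?_⟩⟩
    · refine Fin.addCases (fun j => ?_) (fun j => ?_) i
      · rw [Fin.append_left]; exact h.1 j
      · rw [Fin.append_right]; exact h.2 j
    · simpa only [Fin.append_left] using h (Fin.castAdd n i)
    · simpa only [Fin.append_right] using h (Fin.natAdd m i)
  rw [h, Finset.card_eq_sum_card_fiberwise (f := fun q => ∑ i, q.1 i) (t := univ) (by simp)]
  refine Finset.sum_congr rfl fun x _ => ?_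
  rw [← Finset.card_product]
  congr 1
  ext ⟨f, g⟩
  simp only [Finset.mem_filter, Finset.mem_product]
  constructor
  · rintro ⟨⟨⟨hf, hg⟩, h⟩, rfl⟩
    exact ⟨⟨hf, rfl⟩, hg, eq_sub_of_add_eq' h⟩
  · rintro ⟨⟨hf, rfl⟩, hg, h⟩
    exact ⟨⟨⟨hf, hg⟩, by rw [h]; abel⟩, rfl⟩

theorem card_filter_sum_eq_dyadicConv (A : Finset G) (k : ℕ) (s : G) :
    (((Fintype.piFinset fun _ : Fin (2 ^ k) => A).filter fun f => ∑ i, f i = s).card : ℝ) =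
      dyadicConv A k s := by
  induction k generalizing s with
  | zero =>
    have h : (Fintype.piFinset fun _ : Fin (2 ^ 0) => A).filter (fun f => ∑ i, f i = s) =
        if s ∈ A then {fun _ => s} else ∅ := by
      ext f
      have hsum : ∑ i, f i = f 0 := Fin.sum_univ_one f
      have hext : f = (fun _ => s) ↔ f 0 = s :=
        ⟨fun h => by rw [h], fun h => funext fun i => by rw [Fin.fin_one_eq_zero i, h]⟩
      have hall : (∀ i, f i ∈ A) ↔ f 0 ∈ A :=
        ⟨fun h => h 0, fun h i => by rwa [Fin.fin_one_eq_zero i]⟩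
      rw [Finset.mem_filter, Fintype.mem_piFinset, hsum, hall]
      split_ifs with hs
      · rw [Finset.mem_singleton, hext]
        exact ⟨fun h => h.2, fun h => ⟨h ▸ hs, h⟩⟩
      · simp only [Finset.notMem_empty, iff_false]
        exact fun h => hs (h.2 ▸ h.1)
    rw [h, dyadicConv]
    split_ifs with hs <;> simp [hs]
  | succ k ih =>
    have h2 : 2 ^ (k + 1) = 2 ^ k + 2 ^ k := by ring
    rw [h2, card_filter_sum_append, dyadicConv, addConv]
    push_cast
    simp only [ih]

theorem Tplus_eq_sum_dyadicConv_sq (A : Finset G) (k : ℕ) :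
    (Tplus (2 ^ k) A : ℝ) = ∑ s, dyadicConv A k s ^ 2 := by
  rw [Tplus, card_filter_eq_sum_sq (Fintype.piFinset fun _ : Fin (2 ^ k) => A)
    fun f => ∑ i, f i]
  push_cast
  simp only [card_filter_sum_eq_dyadicConv]

theorem Tplus_succ_eq_weightedEnergy (A : Finset G) (k : ℕ) :
    (Tplus (2 ^ (k + 1)) A : ℝ) = weightedEnergy (dyadicConv A k) :=
  Tplus_eq_sum_dyadicConv_sq A (k + 1)

end WeightedEnergy

theorem dyadicConv_mul_left {F : Type*} [Field F] [Fintype F] [DecidableEq F] {A : Finset F}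
    {γ : F} (hγ : γ ≠ 0) (hA : ∀ x, γ * x ∈ A ↔ x ∈ A) (k : ℕ) (x : F) :
    dyadicConv A k (γ * x) = dyadicConv A k x := by
  induction k generalizing x with
  | zero => simp only [dyadicConv, hA]
  | succ k ih =>
    rw [dyadicConv, addConv, addConv]
    refine (Fintype.sum_equiv (Equiv.mulLeft₀ γ hγ) _ _ fun y => ?_).symm
    rw [Equiv.mulLeft₀_apply, ← mul_sub, ih, ih]

theorem Eplus_image_mul_left {F : Type*} [Field F] [DecidableEq F] {q : F} (hq : q ≠ 0)
    (Γ : Finset F) : Eplus (Γ.image (q * ·)) = Eplus Γ := by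
  let e := Equiv.mulLeft₀ q hq
  have hmem (x : F) : q * x ∈ Γ.image (q * ·) ↔ x ∈ Γ :=
    (mul_right_injective₀ hq).mem_finset_image
  refine (Finset.card_equiv (e.prodCongr (e.prodCongr (e.prodCongr e))) ?_).symm
  rintro ⟨a, b, c, d⟩
  simp only [Finset.mem_filter, Finset.mem_product, Equiv.prodCongr_apply, Prod.map_apply, e,
    Equiv.mulLeft₀_apply, hmem, ← mul_add, mul_right_inj' hq]

theorem Tplus_two_le {p : ℕ} [Fact p.Prime] {Γ Q : Finset (ZMod p)} (hΓ : IsMulSubgroup Γ)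
    (hQ0 : (0 : ZMod p) ∉ Q) (hQ : ∀ γ ∈ Γ, ∀ x ∈ Q, γ * x ∈ Q) :
    (Tplus 2 Q : ℝ) ≤ (Q.card : ℝ) ^ 4 * Eplus Γ / (Γ.card : ℝ) ^ 4 := by
  obtain ⟨hΓ0, hΓ1, -, hΓi⟩ := hΓ
  have hg : (0 : ℝ) < Γ.card := by exact_mod_cast Finset.card_pos.2 ⟨1, hΓ1⟩
  have hne {x : ZMod p} (hx : x ∈ Q) : x ≠ 0 := fun h => hQ0 (h ▸ hx)
  have hcount : ∀ z, ∑ q ∈ Q, (if z ∈ Γ.image (q * ·) then (1 : ℝ) else 0) =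
      Γ.card * dyadicConv Q 0 z := by
    intro z
    rw [Finset.sum_boole]
    simp only [dyadicConv]
    split_ifs with hz
    · rw [mul_one]
      congr 1
      refine (Finset.card_bij (fun γ _ => γ⁻¹ * z) ?_ ?_ ?_).symm
      · intro γ hγ
        refine Finset.mem_filter.2 ⟨hQ _ (hΓi γ hγ) z hz, Finset.mem_image.2 ⟨γ, hγ, ?_⟩⟩
        have : γ ≠ 0 := fun h => hΓ0 (h ▸ hγ)
        field_simp
      · intro γ _ γ' _ h
        exact inv_injective (mul_right_cancel₀ (hne hz) h)
      · intro q hq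
        obtain ⟨hq, h⟩ := Finset.mem_filter.1 hq
        obtain ⟨γ, hγ, rfl⟩ := Finset.mem_image.1 h
        refine ⟨γ, hγ, ?_⟩
        have : γ ≠ 0 := fun h => hΓ0 (h ▸ hγ)
        field_simp
    · rw [mul_zero, Nat.cast_eq_zero, Finset.card_eq_zero, Finset.filter_eq_empty_iff]
      intro q hq h
      obtain ⟨γ, hγ, rfl⟩ := Finset.mem_image.1 h
      exact hz (by simpa only [mul_comm] using hQ γ hγ q hq)
  have h1 := weightedEnergy_sum_le Q
    fun q z => if z ∈ Γ.image (q * ·) then (1 : ℝ) else 0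
  simp only [hcount, weightedEnergy_const_mul, weightedEnergy_indicator] at h1
  rw [Finset.sum_congr rfl fun q hq => by rw [Eplus_image_mul_left (hne hq)],
    ← Tplus_succ_eq_weightedEnergy, Finset.sum_const, nsmul_eq_mul] at h1
  rw [le_div_iff₀ (by positivity)]
  simp only [zero_add, pow_one] at h1
  linarith

theorem weightedEnergy_le_of_invariant {p : ℕ} [Fact p.Prime] {Γ : Finset (ZMod p)}
    (hΓ : IsMulSubgroup Γ) {w : ZMod p → ℝ} (hw : ∀ x, 0 ≤ w x) (hpos : 0 < ∑ x, w x)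
    (hinv : ∀ γ ∈ Γ, ∀ x, w (γ * x) = w x) (h0 : w 0 * Γ.card ≤ ∑ x, w x) {N : ℕ}
    (hN : Γ.card ≤ 2 ^ N) :
    weightedEnergy w ≤ (N + 2 : ℝ) ^ 4 * (16 * 10 ^ 6) *
      ((∑ x, w x) ^ 4 / p + (∑ x, w x) ^ 2 * (∑ x, w x ^ 2) / √(Γ.card)) := by
  have hg1 : 1 ≤ Γ.card := Finset.card_pos.2 ⟨1, hΓ.2.1⟩
  have hp0 : (0 : ℝ) < p := by exact_mod_cast (Fact.out : p.Prime).pos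
  set s := √(Γ.card : ℝ) with hs_def
  have hs1 : 1 ≤ s := Real.one_le_sqrt.2 (by exact_mod_cast hg1)
  have hss : s * s = Γ.card := Real.mul_self_sqrt (by positivity)
  set a := ∑ x, w x
  set b := ∑ x, w x ^ 2 with hb_def
  have hb : 0 < b := by
    obtain ⟨x, -, hx⟩ := Finset.exists_ne_zero_of_sum_ne_zero hpos.ne'
    exact Finset.sum_pos' (fun x _ => sq_nonneg _) ⟨x, Finset.mem_univ _, by positivity⟩
  set δ := b / (s * a) with hδ_def
  have hδ : 0 < δ := by positivity
  let c : ZMod p → ℕ := fun x => if x = 0 then N + 1 else min (N + 1) (Nat.clog 2 ⌈w x / δ⌉₊)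
  let f : ℕ → ZMod p → ℝ := fun j x => if c x = j then w x else 0
  have hclog (x : ZMod p) (y : ℕ) : Nat.clog 2 ⌈w x / δ⌉₊ ≤ y ↔ w x ≤ δ * 2 ^ y := by
    rw [Nat.clog_le_iff_le_pow one_lt_two, Nat.ceil_le, div_le_iff₀ hδ, mul_comm]
    push_cast
    rfl
  have hcN : ∀ x, c x < N + 2 := by
    intro x
    simp only [c]
    split_ifs <;> omega
  have hf0 (j x) : 0 ≤ f j x := by
    simp only [f]; split_ifs; exacts [hw x, le_rfl]
  have hfw (j x) : f j x ≤ w x := by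
    simp only [f]; split_ifs; exacts [le_rfl, hw x]
  have hfa (j) : ∑ x, f j x ≤ a := Finset.sum_le_sum fun x _ => hfw j x
  have hfb (j) : ∑ x, f j x ^ 2 ≤ b :=
    Finset.sum_le_sum fun x _ => pow_le_pow_left₀ (hf0 j x) (hfw j x) 2
  have hfa0 (j) : 0 ≤ ∑ x, f j x := Finset.sum_nonneg fun x _ => hf0 j x
  have hfb0 (j) : 0 ≤ ∑ x, f j x ^ 2 := Finset.sum_nonneg fun x _ => sq_nonneg _
  set M := a ^ 4 / p + a ^ 2 * b / s with hM_def
  have hM1 : 0 ≤ a ^ 4 / p := by positivity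
  have hM2 : 0 ≤ a ^ 2 * b / s := by positivity
  have hsmall : weightedEnergy (f 0) ≤ a ^ 2 * b / s := by
    have h1 : ∑ x, f 0 x ^ 2 ≤ δ * ∑ x, f 0 x := by
      rw [Finset.mul_sum]
      refine Finset.sum_le_sum fun x _ => ?_
      simp only [f]
      split_ifs with h
      · rw [sq]
        refine mul_le_mul_of_nonneg_right ?_ (hw x)
        have h2 : Nat.clog 2 ⌈w x / δ⌉₊ ≤ 0 := by
          simp only [c] at h
          split_ifs at h
          omega
        simpa using (hclog x 0).1 h2
      · simp
    calc weightedEnergy (f 0) ≤ (∑ x, f 0 x) ^ 2 * ∑ x, f 0 x ^ 2 := weightedEnergy_le (hf0 0)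
      _ ≤ a ^ 2 * (δ * a) := by
        have := hfa 0
        have := hfa0 0
        gcongr
        exact h1.trans (by gcongr)
      _ = a ^ 2 * b / s := by
        rw [hδ_def]; field_simp
  have hlarge : weightedEnergy (f (N + 1)) ≤ 4 * (a ^ 2 * b / s) := by
    have hg : s * s ≤ 2 ^ N := by rw [hss]; exact_mod_cast hN
    have h1 : ∑ x, f (N + 1) x ≤ 2 * (a / s) := by
      have h2 : ∀ x, f (N + 1) x ≤ (if x = 0 then w 0 else 0) + a / (s * b) * w x ^ 2 := by
        intro x
        have h3 : 0 ≤ a / (s * b) * w x ^ 2 := by positivity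
        simp only [f]
        split_ifs with h hx hx
        · rw [hx] at h3 ⊢; linarith
        · have h4 : δ * 2 ^ N < w x := by
            rw [← not_le, ← hclog]
            simp only [c, if_neg hx] at h
            omega
          have h5 : s * b / a ≤ w x := by
            refine le_trans ?_ h4.le
            calc s * b / a = δ * (s * s) := by rw [hδ_def]; field_simp
              _ ≤ _ := by gcongr
          have h6 : 1 ≤ a / (s * b) * w x := by
            rw [div_le_iff₀ hpos] at h5
            rw [div_mul_eq_mul_div, one_le_div (by positivity)]
            linarith
          rw [zero_add, sq, ← mul_assoc]
          exact le_mul_of_one_le_left (hw x) h6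
        · exact add_nonneg (hw 0) h3
        · linarith
      have h7 : w 0 ≤ a / s := by
        rw [le_div_iff₀ (by positivity)]
        refine le_trans ?_ h0
        rw [← hss]
        exact mul_le_mul_of_nonneg_left (le_mul_of_one_le_left (by positivity) hs1) (hw 0)
      calc ∑ x, f (N + 1) x ≤ ∑ x, ((if x = 0 then w 0 else 0) + a / (s * b) * w x ^ 2) :=
            Finset.sum_le_sum fun x _ => h2 x
        _ = w 0 + a / (s * b) * b := by
          rw [Finset.sum_add_distrib, ← Finset.mul_sum, Finset.sum_ite_eq', if_pos (mem_univ _)]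
        _ = w 0 + a / s := by congr 1; field_simp
        _ ≤ 2 * (a / s) := by linarith
    calc weightedEnergy (f (N + 1)) ≤ (∑ x, f (N + 1) x) ^ 2 * ∑ x, f (N + 1) x ^ 2 :=
          weightedEnergy_le (hf0 _)
      _ ≤ (2 * (a / s)) ^ 2 * b := by
        have := hfa0 (N + 1)
        have := hfb (N + 1)
        gcongr
      _ = 4 * (a ^ 2 * b / s) / s := by field_simp; ring
      _ ≤ 4 * (a ^ 2 * b / s) := div_le_self (by positivity) hs1
  have hmid : ∀ j, j < N → weightedEnergy (f (j + 1)) ≤ 16 * 10 ^ 6 * M := by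
    intro j hj
    set P : Finset (ZMod p) := univ.filter fun x => c x = j + 1 with hP
    have hP0 : (0 : ZMod p) ∉ P := by
      simp only [hP, Finset.mem_filter, c, if_true]
      omega
    have hPinv : ∀ γ ∈ Γ, ∀ x ∈ P, γ * x ∈ P := by
      intro γ hγ x hx
      have hγ0 : γ ≠ 0 := fun h => hΓ.1 (h ▸ hγ)
      rw [hP, Finset.mem_filter] at hx ⊢
      refine ⟨mem_univ _, ?_⟩
      rw [← hx.2]
      simp only [c, mul_eq_zero, hγ0, false_or, hinv γ hγ]
    set l := δ * 2 ^ j with hl_def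
    have hl : 0 < l := by positivity
    have hPl : ∀ x ∈ P, l < w x ∧ w x ≤ 2 * l := by
      intro x hx
      have hc := (Finset.mem_filter.1 hx).2
      have hx0 : x ≠ 0 := fun h => hP0 (h ▸ hx)
      simp only [c, if_neg hx0] at hc
      constructor
      · rw [← not_le, ← hclog]; omega
      · have : w x ≤ δ * 2 ^ (j + 1) := by rw [← hclog]; omega
        rw [pow_succ] at this
        linarith
    have hle : weightedEnergy (f (j + 1)) ≤ (2 * l) ^ 4 * Eplus P := by
      rw [← weightedEnergy_indicator, ← weightedEnergy_const_mul]
      refine weightedEnergy_mono (hf0 _) fun x => ?_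
      by_cases hx : x ∈ P
      · rw [if_pos hx, mul_one]
        exact (hfw _ x).trans (hPl x hx).2
      · rw [if_neg hx, mul_zero]
        refine le_of_eq (if_neg fun h => hx ?_)
        exact Finset.mem_filter.2 ⟨mem_univ _, h⟩
    have ha : l * P.card ≤ a := by
      rw [mul_comm, ← nsmul_eq_mul]
      refine (Finset.card_nsmul_le_sum P w l fun x hx => (hPl x hx).1.le).trans ?_
      exact Finset.sum_le_sum_of_subset_of_nonneg (subset_univ _) fun x _ _ => hw x
    have hb' : l ^ 2 * P.card ≤ b := by
      rw [mul_comm, ← nsmul_eq_mul]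
      refine (Finset.card_nsmul_le_sum P (fun x => w x ^ 2) (l ^ 2) fun x hx =>
        pow_le_pow_left₀ hl.le (hPl x hx).1.le 2).trans ?_
      exact Finset.sum_le_sum_of_subset_of_nonneg (subset_univ _) fun x _ _ => sq_nonneg _
    calc weightedEnergy (f (j + 1)) ≤ (2 * l) ^ 4 * Eplus P := hle
      _ ≤ (2 * l) ^ 4 * (10 ^ 6 * ((P.card : ℝ) ^ 4 / p + (P.card : ℝ) ^ 3 / s)) := by
        gcongr
        exact Eplus_le_of_invariant hΓ hPinv hP0
      _ = 16 * 10 ^ 6 * ((l * P.card) ^ 4 / p + (l * P.card) ^ 2 * (l ^ 2 * P.card) / s) := by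
        ring
      _ ≤ 16 * 10 ^ 6 * M := by
        rw [hM_def]
        gcongr
  have hall : ∀ j ∈ Finset.range (N + 2), weightedEnergy (f j) ≤ 16 * 10 ^ 6 * M := by
    intro j hj
    rcases j with _ | j
    · linarith
    · rcases (Nat.lt_succ_iff.1 (Nat.lt_of_succ_lt_succ (Finset.mem_range.1 hj))).lt_or_eq with
        h | rfl
      · exact hmid j h
      · linarith
  have hsum : w = fun x => ∑ j ∈ Finset.range (N + 2), f j x := by
    funext x
    simp only [f]
    rw [Finset.sum_ite_eq, if_pos (Finset.mem_range.2 (hcN x))]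
  calc weightedEnergy w = weightedEnergy fun x => ∑ j ∈ Finset.range (N + 2), f j x := by
        rw [← hsum]
    _ ≤ ((Finset.range (N + 2)).card : ℝ) ^ 3 *
          ∑ j ∈ Finset.range (N + 2), weightedEnergy (f j) := weightedEnergy_sum_le _ _
    _ ≤ ((Finset.range (N + 2)).card : ℝ) ^ 3 *
          ((Finset.range (N + 2)).card • (16 * 10 ^ 6 * M)) := by
        refine mul_le_mul_of_nonneg_left (Finset.sum_le_card_nsmul _ _ _ hall) ?_
        exact pow_nonneg (Nat.cast_nonneg _) 3
    _ = (N + 2 : ℝ) ^ 4 * (16 * 10 ^ 6) * M := by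
        rw [nsmul_eq_mul, Finset.card_range]; push_cast; ring

theorem two_mul_logb_pow_four_le_sqrt {x C : ℝ} (hC : 1 ≤ C) (hx : (2 : ℝ) ^ 128 * C ^ 4 ≤ x) :
    2 * (C * Real.logb 2 x ^ 4) ≤ √x := by
  have h1 : 1 ≤ x := by
    have : (1 : ℝ) ≤ C ^ 4 := one_le_pow₀ hC
    linarith
  have hx0 : 0 < x := one_pos.trans_le h1
  have hC0 : 0 < C := one_pos.trans_le hC
  set v := x ^ (1 / 16 : ℝ)
  have hv : 0 < v := Real.rpow_pos_of_pos hx0 _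
  have hv16 : v ^ 16 = x := by
    rw [← Real.rpow_natCast, ← Real.rpow_mul hx0.le]
    norm_num
  have hs : √x = v ^ 8 := by
    rw [← hv16, show v ^ 16 = (v ^ 8) ^ 2 by ring, Real.sqrt_sq (by positivity)]
  have hv4 : 2 ^ 32 * C ≤ v ^ 4 := by
    refine le_of_pow_le_pow_left₀ (n := 4) (by norm_num) (by positivity) ?_
    calc (2 ^ 32 * C) ^ 4 = (2 : ℝ) ^ 128 * C ^ 4 := by ring
      _ ≤ x := hx
      _ = (v ^ 4) ^ 4 := by rw [← hv16]; ring
  have hlog : Real.logb 2 x ≤ 32 * v := by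
    have h2 : Real.log x ≤ v / (1 / 16) := Real.log_le_rpow_div hx0.le (by norm_num)
    have h3 : 0.6931471803 < Real.log 2 := Real.log_two_gt_d9
    rw [Real.logb, div_le_iff₀ (by linarith)]
    nlinarith
  have hlog0 : 0 ≤ Real.logb 2 x := Real.logb_nonneg one_lt_two h1
  calc 2 * (C * Real.logb 2 x ^ 4) ≤ 2 * (C * (32 * v) ^ 4) := by gcongr
    _ = 2 ^ 21 * C * v ^ 4 := by ring
    _ ≤ v ^ 4 * v ^ 4 := by
      gcongr
      refine le_trans ?_ hv4
      gcongr <;> norm_num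
    _ = √x := by rw [hs]; ring

theorem Tplus_succ_le {p : ℕ} [Fact p.Prime] {Γ Q : Finset (ZMod p)} (hΓ : IsMulSubgroup Γ)
    (hQ0 : (0 : ZMod p) ∉ Q) (hQ : ∀ γ ∈ Γ, ∀ x ∈ Q, γ * x ∈ Q) (hne : Q.Nonempty)
    (hΓ8 : 8 ≤ Γ.card) (k : ℕ) :
    (Tplus (2 ^ (k + 1)) Q : ℝ) ≤ 256 * 10 ^ 6 * Real.logb 2 Γ.card ^ 4 *
      ((Q.card : ℝ) ^ 2 ^ (k + 2) / p +
        (Q.card : ℝ) ^ 2 ^ (k + 1) * Tplus (2 ^ k) Q / √(Γ.card)) := by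
  have hγ0 {γ : ZMod p} (hγ : γ ∈ Γ) : γ ≠ 0 := fun h => hΓ.1 (h ▸ hγ)
  have hiff : ∀ γ ∈ Γ, ∀ x, γ * x ∈ Q ↔ x ∈ Q := by
    refine fun γ hγ x => ⟨fun h => ?_, hQ γ hγ x⟩
    simpa only [inv_mul_cancel_left₀ (hγ0 hγ)] using hQ _ (hΓ.2.2.2 γ hγ) _ h
  have hcard : (Γ.card : ℝ) ≤ Q.card := by
    exact_mod_cast card_le_card_of_invariant hQ hQ0 hne
  have hq : (0 : ℝ) < Q.card := by exact_mod_cast hne.card_pos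
  have hE := weightedEnergy_le_of_invariant hΓ (dyadicConv_nonneg Q k)
    (by rw [sum_dyadicConv]; positivity)
    (fun γ hγ x => dyadicConv_mul_left (hγ0 hγ) (hiff γ hγ) k x)
    (by
      rw [sum_dyadicConv]
      exact (mul_le_mul_of_nonneg_left hcard (dyadicConv_nonneg Q k 0)).trans
        (dyadicConv_mul_card_le Q k 0))
    (Nat.le_pow_clog one_lt_two Γ.card)
  rw [← Tplus_succ_eq_weightedEnergy, sum_dyadicConv, ← Tplus_eq_sum_dyadicConv_sq] at hE
  have hl : (3 : ℝ) ≤ Real.logb 2 Γ.card := by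
    rw [Real.le_logb_iff_rpow_le one_lt_two (by exact_mod_cast (by omega : 0 < Γ.card))]
    norm_num
    exact_mod_cast hΓ8
  have hN : (Nat.clog 2 Γ.card + 2 : ℝ) ≤ 2 * Real.logb 2 Γ.card := by
    have h1 := (Nat.ceil_lt_add_one (by linarith : 0 ≤ Real.logb 2 Γ.card)).le
    have h2 := Real.natCeil_logb_natCast 2 Γ.card
    push_cast at h2
    rw [h2] at h1
    linarith
  calc (Tplus (2 ^ (k + 1)) Q : ℝ) ≤ _ := hE
    _ ≤ (2 * Real.logb 2 Γ.card) ^ 4 * (16 * 10 ^ 6) * (((Q.card : ℝ) ^ 2 ^ k) ^ 4 / p +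
        ((Q.card : ℝ) ^ 2 ^ k) ^ 2 * Tplus (2 ^ k) Q / √(Γ.card)) := by gcongr
    _ = _ := by
      rw [← pow_mul, ← pow_mul, pow_succ 2 (k + 1), pow_succ 2 k]
      ring

theorem Tplus_le_of_two_mul_le_sqrt {p : ℕ} [Fact p.Prime] {Γ Q : Finset (ZMod p)}
    (hΓ : IsMulSubgroup Γ) (hQ0 : (0 : ZMod p) ∉ Q) (hQ : ∀ γ ∈ Γ, ∀ x ∈ Q, γ * x ∈ Q)
    (hne : Q.Nonempty) (hΓ8 : 8 ≤ Γ.card) {L : ℝ}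
    (hL : 256 * 10 ^ 6 * Real.logb 2 Γ.card ^ 4 = L) (hLs : 2 * L ≤ √(Γ.card)) (j : ℕ) :
    (Tplus (2 ^ (j + 1)) Q : ℝ) ≤ (2 * L / p + (L / √(Γ.card)) ^ j *
      (Eplus Γ / (Γ.card : ℝ) ^ 4)) * (Q.card : ℝ) ^ 2 ^ (j + 2) := by
  have hL0 : 0 ≤ L := by rw [← hL]; positivity
  have hs : 0 < √(Γ.card : ℝ) := Real.sqrt_pos.2 (by exact_mod_cast (by omega : 0 < Γ.card))
  induction j with
  | zero =>
    have h := Tplus_two_le hΓ hQ0 hQ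
    have h2 : 0 ≤ 2 * L / p * (Q.card : ℝ) ^ 4 := by positivity
    norm_num
    rw [add_mul]
    refine h.trans (le_trans (le_of_eq ?_) (le_add_of_nonneg_left h2))
    ring
  | succ j ih =>
    have h := Tplus_succ_le hΓ hQ0 hQ hne hΓ8 (j + 1)
    rw [hL] at h
    set q := (Q.card : ℝ)
    set s := √(Γ.card : ℝ)
    set B := Eplus Γ / (Γ.card : ℝ) ^ 4
    have hq : q ^ 2 ^ (j + 1 + 2) = q ^ 2 ^ (j + 2) * q ^ 2 ^ (j + 2) := by
      rw [← pow_add]; congr 1; ring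
    have h1 : 2 * L / s ≤ 1 := (div_le_one hs).2 hLs
    have h3 : 0 ≤ L / p * q ^ 2 ^ (j + 1 + 2) := by positivity
    calc (Tplus (2 ^ (j + 1 + 1)) Q : ℝ) ≤ _ := h
      _ ≤ L * (q ^ 2 ^ (j + 1 + 2) / p + q ^ 2 ^ (j + 2) *
          ((2 * L / p + (L / s) ^ j * B) * q ^ 2 ^ (j + 2)) / s) := by gcongr
      _ = L / p * q ^ 2 ^ (j + 1 + 2) + 2 * L / s * (L / p * q ^ 2 ^ (j + 1 + 2)) +
          (L / s) ^ (j + 1) * B * q ^ 2 ^ (j + 1 + 2) := by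
        rw [hq]; ring
      _ ≤ L / p * q ^ 2 ^ (j + 1 + 2) + 1 * (L / p * q ^ 2 ^ (j + 1 + 2)) +
          (L / s) ^ (j + 1) * B * q ^ 2 ^ (j + 1 + 2) := by gcongr
      _ = _ := by ring

/-- there is an absolute constant `C ≥ 1` such that for every odd prime `p`,
every multiplicative subgroup `Γ ⊆ F_p^*`, every `Q ⊆ F_p^*` with `QΓ = Q`, and every
integer `k ≥ 2` with `2^{64k} C⁴ ≤ |Γ|`,
`T⁺_{2^k}(Q) ≤ 2^{4k+6} C (log|Γ|)⁴ |Q|^{2^{k+1}}/p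
   + 16^{k²} C^{k−1} (log|Γ|)^{4(k−1)} |Γ|^{−(k+7)/2} E⁺(Γ) |Q|^{2^{k+1}}`. -/
theorem stmt_4 :
    ∃ C : ℝ, 1 ≤ C ∧
      ∀ (p : ℕ) [Fact p.Prime], Odd p →
        ∀ (Γ Q : Finset (ZMod p)), IsMulSubgroup Γ →
          (0 : ZMod p) ∉ Q → Q * Γ = Q →
          ∀ k : ℕ, 2 ≤ k → (2 : ℝ) ^ (64 * k) * C ^ 4 ≤ Γ.card →
            (Tplus (2 ^ k) Q : ℝ) ≤
              2 ^ (4 * k + 6) * C * (Real.logb 2 Γ.card) ^ 4 * (Q.card : ℝ) ^ (2 ^ (k + 1)) / p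
              + 16 ^ (k ^ 2) * C ^ (k - 1) * (Real.logb 2 Γ.card) ^ (4 * (k - 1)) *
                  (Γ.card : ℝ) ^ (-(((k : ℝ) + 7) / 2)) * (Eplus Γ : ℝ) *
                  (Q.card : ℝ) ^ (2 ^ (k + 1)) := by
  refine ⟨256 * 10 ^ 6, by norm_num, ?_⟩
  intro p _ _ Γ Q hΓ hQ0 hQΓ k hk hbig
  set C : ℝ := 256 * 10 ^ 6 with hC
  have hC1 : 1 ≤ C := by norm_num [hC]
  have hQ : ∀ γ ∈ Γ, ∀ x ∈ Q, γ * x ∈ Q := by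
    intro γ hγ x hx
    rw [← hQΓ, mul_comm γ x]
    exact Finset.mul_mem_mul hx hγ
  have hbig2 : (2 : ℝ) ^ 128 * C ^ 4 ≤ Γ.card := by
    refine le_trans ?_ hbig
    gcongr
    · norm_num
    · omega
  have h8 : (8 : ℝ) ≤ Γ.card := by
    refine le_trans ?_ hbig2
    have : (1 : ℝ) ≤ C ^ 4 := one_le_pow₀ hC1
    nlinarith
  have hΓ8 : 8 ≤ Γ.card := by exact_mod_cast h8
  set ℓ := Real.logb 2 Γ.card
  set g := (Γ.card : ℝ)
  have hg0 : 0 < g := by linarith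
  have hl0 : 0 ≤ ℓ := Real.logb_nonneg one_lt_two (by linarith)
  have hs := two_mul_logb_pow_four_le_sqrt hC1 hbig2
  have hrpow : g ^ (-(((k : ℝ) + 7) / 2)) = (√g ^ (k - 1))⁻¹ * (g ^ 4)⁻¹ := by
    have h1 : √g ^ 8 = g ^ 4 := by
      rw [show 8 = 2 * 4 by norm_num, pow_mul, Real.sq_sqrt hg0.le]
    rw [← mul_inv, ← h1, ← pow_add, Real.rpow_neg hg0.le, ← Real.rpow_natCast,
      Real.sqrt_eq_rpow, ← Real.rpow_mul hg0.le]
    congr 2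
    rw [show k - 1 + 8 = k + 7 by omega]
    push_cast
    ring
  have hpos : 0 ≤ C ^ (k - 1) * ℓ ^ (4 * (k - 1)) * g ^ (-(((k : ℝ) + 7) / 2)) * (Eplus Γ : ℝ) *
      (Q.card : ℝ) ^ (2 ^ (k + 1)) := by positivity
  have hpos' : 0 ≤ C * ℓ ^ 4 * (Q.card : ℝ) ^ (2 ^ (k + 1)) / p := by positivity
  have hmain : (Tplus (2 ^ k) Q : ℝ) ≤ 2 * (C * ℓ ^ 4 * (Q.card : ℝ) ^ (2 ^ (k + 1)) / p) +
      C ^ (k - 1) * ℓ ^ (4 * (k - 1)) * g ^ (-(((k : ℝ) + 7) / 2)) * (Eplus Γ : ℝ) *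
      (Q.card : ℝ) ^ (2 ^ (k + 1)) := by
    rcases Q.eq_empty_or_nonempty with rfl | hne
    · have : Tplus (2 ^ k) (∅ : Finset (ZMod p)) = 0 := by
        have : Nonempty (Fin (2 ^ k)) := ⟨⟨0, by positivity⟩⟩
        simp [Tplus]
      rw [this, Nat.cast_zero]
      linarith
    · have h := Tplus_le_of_two_mul_le_sqrt hΓ hQ0 hQ hne hΓ8 rfl hs (k - 1)
      rw [show k - 1 + 1 = k by omega, show k - 1 + 2 = k + 1 by omega] at h
      refine h.trans (le_of_eq ?_)
      rw [hrpow, pow_mul, div_pow, mul_pow]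
      ring
  have e1 : (2 : ℝ) ≤ 2 ^ (4 * k + 6) := le_self_pow₀ one_le_two (by omega)
  have e2 : (1 : ℝ) ≤ 16 ^ (k ^ 2) := one_le_pow₀ (by norm_num)
  calc (Tplus (2 ^ k) Q : ℝ) ≤ _ := hmain
    _ ≤ 2 ^ (4 * k + 6) * (C * ℓ ^ 4 * (Q.card : ℝ) ^ (2 ^ (k + 1)) / p) +
      16 ^ (k ^ 2) * (C ^ (k - 1) * ℓ ^ (4 * (k - 1)) * g ^ (-(((k : ℝ) + 7) / 2)) *
        (Eplus Γ : ℝ) * (Q.card : ℝ) ^ (2 ^ (k + 1))) :=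
      add_le_add (mul_le_mul_of_nonneg_right e1 hpos') (le_mul_of_one_le_left hpos e2)
    _ = _ := by ring
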